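/- arXiv:1909.13152 — 6 statements merged into one kernel-verified Lean document; each statement's English description precedes it below -/
import Mathlib

section
/- Let ρ be a pure quadripartite qudit state on ℂ^d ⊗ ℂ^d ⊗ ℂ^d ⊗ ℂ^d. Then for each triple of parties, the sum of the isotropic strengths of its three pairs satisfies: s_iso^{BC} + s_iso^{AC} + s_iso^{AB} = (d²(1+‖d‖²) − (1+‖a‖²+‖b‖²+‖c‖²) − ‖R^{ABC}‖²)/(d²−1), s_iso^{CD} + s_iso^{AC} + s_iso^{AD} = (d²(1+‖b‖²) − (1+‖a‖²+‖c‖²+‖d‖²) − ‖R^{ACD}‖²)/(d²−1), s_iso^{BC} + s_iso^{CD} + s_iso^{BD} = (d²(1+‖a‖²) − (1+‖b‖²+‖c‖²+‖d‖²) − ‖R^{BCD}‖²)/(d²−1), and s_iso^{AB} + s_iso^{AD} + s_iso^{BD} = (d²(1+‖c‖²) − (1+‖a‖²+‖b‖²+‖d‖²) − ‖R^{ABD}‖²)/(d²−1). -/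
open Matrix ComplexOrder

namespace SpinCorr4

variable {d : ℕ}

/-- Tensor (Kronecker) product of four `d × d` matrices, acting on `(ℂ^d)^{⊗4}`. -/
noncomputable def kron4 (A B C D : Matrix (Fin d) (Fin d) ℂ) :
    Matrix (Fin d × Fin d × Fin d × Fin d) (Fin d × Fin d × Fin d × Fin d) ℂ :=
  Matrix.of fun p q =>
    A p.1 q.1 * B p.2.1 q.2.1 * C p.2.2.1 q.2.2.1 * D p.2.2.2 q.2.2.2

variable (lam : Fin (d ^ 2 - 1) → Matrix (Fin d) (Fin d) ℂ)
variable (ρ : Matrix (Fin d × Fin d × Fin d × Fin d) (Fin d × Fin d × Fin d × Fin d) ℂ)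

/-- `‖a‖²`, the squared Euclidean norm of the Bloch vector of party A. -/
noncomputable def aSq : ℝ := ∑ i, ‖(ρ * kron4 (lam i) 1 1 1).trace‖ ^ 2

/-- `‖b‖²`. -/
noncomputable def bSq : ℝ := ∑ i, ‖(ρ * kron4 1 (lam i) 1 1).trace‖ ^ 2

/-- `‖c‖²`. -/
noncomputable def cSq : ℝ := ∑ i, ‖(ρ * kron4 1 1 (lam i) 1).trace‖ ^ 2

/-- `‖d‖²`. -/
noncomputable def dSq : ℝ := ∑ i, ‖(ρ * kron4 1 1 1 (lam i)).trace‖ ^ 2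

/-- `‖R^{AB}‖²`, squared Frobenius norm of the spin correlation matrix of parties A,B. -/
noncomputable def RABsq : ℝ := ∑ i, ∑ j, ‖(ρ * kron4 (lam i) (lam j) 1 1).trace‖ ^ 2

/-- `‖R^{AC}‖²`. -/
noncomputable def RACsq : ℝ := ∑ i, ∑ j, ‖(ρ * kron4 (lam i) 1 (lam j) 1).trace‖ ^ 2

/-- `‖R^{AD}‖²`. -/
noncomputable def RADsq : ℝ := ∑ i, ∑ j, ‖(ρ * kron4 (lam i) 1 1 (lam j)).trace‖ ^ 2

/-- `‖R^{BC}‖²`. -/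
noncomputable def RBCsq : ℝ := ∑ i, ∑ j, ‖(ρ * kron4 1 (lam i) (lam j) 1).trace‖ ^ 2

/-- `‖R^{BD}‖²`. -/
noncomputable def RBDsq : ℝ := ∑ i, ∑ j, ‖(ρ * kron4 1 (lam i) 1 (lam j)).trace‖ ^ 2

/-- `‖R^{CD}‖²`. -/
noncomputable def RCDsq : ℝ := ∑ i, ∑ j, ‖(ρ * kron4 1 1 (lam i) (lam j)).trace‖ ^ 2

/-- `‖R^{ABC}‖²`, squared Euclidean norm of the three-body correlation tensor of A,B,C. -/
noncomputable def RABCsq : ℝ :=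
  ∑ i, ∑ j, ∑ l, ‖(ρ * kron4 (lam i) (lam j) (lam l) 1).trace‖ ^ 2

/-- `‖R^{ABD}‖²`. -/
noncomputable def RABDsq : ℝ :=
  ∑ i, ∑ j, ∑ l, ‖(ρ * kron4 (lam i) (lam j) 1 (lam l)).trace‖ ^ 2

/-- `‖R^{ACD}‖²`. -/
noncomputable def RACDsq : ℝ :=
  ∑ i, ∑ j, ∑ l, ‖(ρ * kron4 (lam i) 1 (lam j) (lam l)).trace‖ ^ 2

/-- `‖R^{BCD}‖²`. -/
noncomputable def RBCDsq : ℝ :=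
  ∑ i, ∑ j, ∑ l, ‖(ρ * kron4 1 (lam i) (lam j) (lam l)).trace‖ ^ 2

/-- `‖R^{ABCD}‖²`, squared Euclidean norm of the four-body correlation tensor. -/
noncomputable def RABCDsq : ℝ :=
  ∑ i, ∑ j, ∑ l, ∑ m, ‖(ρ * kron4 (lam i) (lam j) (lam l) (lam m)).trace‖ ^ 2

/-- Isotropic strength `s_iso^{AB} = ‖R^{AB}‖²/(d²-1)`. -/
noncomputable def sAB : ℝ := RABsq lam ρ / ((d : ℝ) ^ 2 - 1)

/-- `s_iso^{AC}`. -/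
noncomputable def sAC : ℝ := RACsq lam ρ / ((d : ℝ) ^ 2 - 1)

/-- `s_iso^{AD}`. -/
noncomputable def sAD : ℝ := RADsq lam ρ / ((d : ℝ) ^ 2 - 1)

/-- `s_iso^{BC}`. -/
noncomputable def sBC : ℝ := RBCsq lam ρ / ((d : ℝ) ^ 2 - 1)

/-- `s_iso^{BD}`. -/
noncomputable def sBD : ℝ := RBDsq lam ρ / ((d : ℝ) ^ 2 - 1)

/-- `s_iso^{CD}`. -/
noncomputable def sCD : ℝ := RCDsq lam ρ / ((d : ℝ) ^ 2 - 1)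

open scoped Kronecker

/-- A family of matrices satisfying the completeness relation
`∑ α, H α p q * conj (H α r s) = c δ_{pr} δ_{qs}`. -/
def IsTightFamily {ι n : Type*} [Fintype ι] [DecidableEq n]
    (H : ι → Matrix n n ℂ) (c : ℂ) : Prop :=
  ∀ p q r s, ∑ α, H α p q * star (H α r s) = if p = r ∧ q = s then c else 0

theorem IsTightFamily.kronecker {ι κ m n : Type*} [Fintype ι] [Fintype κ]
    [DecidableEq m] [DecidableEq n] {H : ι → Matrix m m ℂ} {K : κ → Matrix n n ℂ} {c e : ℂ}
    (hH : IsTightFamily H c) (hK : IsTightFamily K e) :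
    IsTightFamily (fun x : ι × κ => H x.1 ⊗ₖ K x.2) (c * e) := by
  rintro ⟨p, p'⟩ ⟨q, q'⟩ ⟨r, r'⟩ ⟨s, s'⟩
  have h := congrArg₂ (· * ·) (hH p q r s) (hK p' q' r' s')
  simp only [Finset.sum_mul_sum] at h
  rw [Fintype.sum_prod_type]
  simp only [kroneckerMap_apply, star_mul', Prod.mk.injEq]
  rw [show (if (p = r ∧ p' = r') ∧ q = s ∧ q' = s' then c * e else 0) =
    (if p = r ∧ q = s then c else 0) * (if p' = r' ∧ q' = s' then e else 0) by
      split_ifs <;> simp_all, ← h]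
  exact Finset.sum_congr rfl fun _ _ => Finset.sum_congr rfl fun _ _ => by ring

/-- Parseval's identity for a tight family of matrices. -/
theorem IsTightFamily.sum_norm_trace_sq {ι n : Type*} [Fintype ι] [Fintype n] [DecidableEq n]
    {H : ι → Matrix n n ℂ} {c : ℂ} (hH : IsTightFamily H c) (X : Matrix n n ℂ) :
    ((∑ α, ‖(X * H α).trace‖ ^ 2 : ℝ) : ℂ) = c * ∑ p, ∑ q, X p q * star (X p q) := by
  have key : ∀ α, ((‖(X * H α).trace‖ ^ 2 : ℝ) : ℂ) =
      ∑ x : n × n, ∑ y : n × n,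
        (X x.1 x.2 * star (X y.1 y.2)) * (H α x.2 x.1 * star (H α y.2 y.1)) := by
    intro α
    have ht : (X * H α).trace = ∑ x : n × n, X x.1 x.2 * H α x.2 x.1 := by
      simp [Matrix.trace, Matrix.mul_apply, Fintype.sum_prod_type]
    rw [Complex.ofReal_pow, ← Complex.mul_conj', ht, map_sum, Finset.sum_mul_sum]
    refine Finset.sum_congr rfl fun _ _ => Finset.sum_congr rfl fun _ _ => ?_
    simp only [map_mul, starRingEnd_apply]
    ring
  push_cast
  simp only [← Complex.ofReal_pow, key]
  rw [Finset.sum_comm]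
  simp_rw [Finset.sum_comm (s := (Finset.univ : Finset ι)), ← Finset.mul_sum, hH _ _ _ _]
  have hdiag : ∀ x y : n × n, (x.2 = y.2 ∧ x.1 = y.1) ↔ x = y := by
    intro x y
    rw [Prod.ext_iff, and_comm]
  simp only [hdiag, mul_ite, mul_zero, Finset.sum_ite_eq, Finset.mem_univ, if_true]
  rw [Fintype.sum_prod_type, Finset.mul_sum]
  simp only [Finset.sum_mul, mul_comm c]

/-- The family consisting of the identity together with the matrices `lam i`. -/
def withOne (lam : Fin (d ^ 2 - 1) → Matrix (Fin d) (Fin d) ℂ) :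
    Option (Fin (d ^ 2 - 1)) → Matrix (Fin d) (Fin d) ℂ :=
  fun o => o.elim 1 lam

theorem isTightFamily_withOne (hd : 2 ≤ d) {lam : Fin (d ^ 2 - 1) → Matrix (Fin d) (Fin d) ℂ}
    (hherm : ∀ i, (lam i).IsHermitian) (htr0 : ∀ i, (lam i).trace = 0)
    (horth : ∀ i j, (lam i * lam j).trace = if i = j then (d : ℂ) else 0) :
    IsTightFamily (withOne lam) (d : ℂ) := by
  have hd0 : (d : ℂ) ≠ 0 := by
    have : d ≠ 0 := by omega
    exact_mod_cast this
  have hG : ∀ i, (withOne lam i).IsHermitian := by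
    rintro (_ | i)
    · exact isHermitian_one
    · exact hherm i
  have hO : ∀ i j, (withOne lam i * withOne lam j).trace = if i = j then (d : ℂ) else 0 := by
    rintro (_ | i) (_ | j) <;> simp [withOne, htr0, horth]
  have hcard : Fintype.card (Option (Fin (d ^ 2 - 1))) = Fintype.card (Fin d × Fin d) := by
    have : 0 < d ^ 2 := by positivity
    simp only [Fintype.card_option, Fintype.card_fin, Fintype.card_prod]
    rw [← sq]
    omega
  let M : Matrix (Option (Fin (d ^ 2 - 1))) (Fin d × Fin d) ℂ :=
    Matrix.of fun i x => withOne lam i x.1 x.2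
  let N : Matrix (Fin d × Fin d) (Option (Fin (d ^ 2 - 1))) ℂ :=
    Matrix.of fun x i => (d : ℂ)⁻¹ * withOne lam i x.2 x.1
  have hMN : M * N = 1 := by
    ext i j
    have h := hO i j
    simp only [Matrix.trace, Matrix.diag_apply, Matrix.mul_apply] at h
    simp only [M, N, Matrix.mul_apply, Matrix.of_apply, Fintype.sum_prod_type, Matrix.one_apply]
    simp only [mul_left_comm _ (d : ℂ)⁻¹, ← Finset.mul_sum, h]
    split_ifs <;> simp [hd0]
  have hNM : N * M = 1 := (Matrix.mul_eq_one_comm_of_card_eq _ _ _ hcard).1 hMN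
  intro p q r s
  have h := congrFun (congrFun hNM (r, s)) (p, q)
  simp only [M, N, Matrix.mul_apply, Matrix.of_apply, Matrix.one_apply, mul_assoc,
    ← Finset.mul_sum, Prod.mk.injEq] at h
  rw [inv_mul_eq_iff_eq_mul₀ hd0] at h
  simp only [fun i => (hG i).apply s r, mul_comm (withOne lam _ p q), h, eq_comm (a := r),
    eq_comm (a := s), mul_ite, mul_one, mul_zero]

/-- A Hermitian idempotent of trace one has rank one, expressed entrywise. -/
theorem mul_apply_swap_of_pure {n : Type*} [Fintype n] [DecidableEq n] {ρ : Matrix n n ℂ}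
    (hherm : ρ.IsHermitian) (htr : ρ.trace = 1) (hpure : ρ * ρ = ρ) (p r s t : n) :
    ρ p r * ρ s t = ρ p t * ρ s r := by
  obtain ⟨q, hq⟩ : ∃ q, ρ q q ≠ 0 := by
    by_contra! h
    simp [Matrix.trace, h] at htr
  have hmul : ∀ i j, ∑ k, ρ i k * ρ k j = ρ i j := fun i j => by
    rw [← Matrix.mul_apply, hpure]
  have hqq : star (ρ q q) = ρ q q := hherm.apply q q
  have htr' : ∑ i, ρ i i = 1 := htr
  have hzero : ∑ i, ∑ j, (ρ i j - (ρ q q)⁻¹ * (ρ i q * ρ q j)) *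
      star (ρ i j - (ρ q q)⁻¹ * (ρ i q * ρ q j)) = 0 := by
    have : ∀ i, ∑ j, (ρ i j - (ρ q q)⁻¹ * (ρ i q * ρ q j)) *
        star (ρ i j - (ρ q q)⁻¹ * (ρ i q * ρ q j)) = ρ i i - (ρ q q)⁻¹ * (ρ q i * ρ i q) := by
      intro i
      simp only [star_sub, star_mul', star_inv₀, hqq, hherm.apply]
      have e : ∀ j, (ρ i j - (ρ q q)⁻¹ * (ρ i q * ρ q j)) *
          (ρ j i - (ρ q q)⁻¹ * (ρ q i * ρ j q)) = ρ i j * ρ j i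
            - (ρ q q)⁻¹ * ρ q i * (ρ i j * ρ j q) - (ρ q q)⁻¹ * ρ i q * (ρ q j * ρ j i)
            + (ρ q q)⁻¹ * (ρ q q)⁻¹ * ρ i q * ρ q i * (ρ q j * ρ j q) := fun j => by ring
      simp only [e, Finset.sum_add_distrib, Finset.sum_sub_distrib, ← Finset.mul_sum, hmul]
      field_simp
      ring
    simp only [this, Finset.sum_sub_distrib, ← Finset.mul_sum, hmul, htr']
    field_simp
    simp
  have hnn : ∀ z : ℂ, 0 ≤ z * star z := fun z => mul_star_self_nonneg z
  have hentry : ∀ i j, ρ i j = (ρ q q)⁻¹ * (ρ i q * ρ q j) := by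
    intro i j
    rw [Finset.sum_eq_zero_iff_of_nonneg fun i _ => Finset.sum_nonneg fun j _ => hnn _] at hzero
    have h1 := hzero i (Finset.mem_univ i)
    rw [Finset.sum_eq_zero_iff_of_nonneg fun j _ => hnn _] at h1
    have h2 := h1 j (Finset.mem_univ j)
    rw [mul_eq_zero, star_eq_zero, or_self] at h2
    exact sub_eq_zero.1 h2
  rw [hentry p r, hentry s t, hentry p t, hentry s r]
  ring

/-- The partial trace over the last party. -/
def traceLast (ρ : Matrix (Fin d × Fin d × Fin d × Fin d) (Fin d × Fin d × Fin d × Fin d) ℂ) :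
    Matrix (Fin d × Fin d × Fin d) (Fin d × Fin d × Fin d) ℂ :=
  Matrix.of fun p q => ∑ l, ρ (p.1, p.2.1, p.2.2, l) (q.1, q.2.1, q.2.2, l)

/-- The partial trace over the first three parties. -/
def traceInit (ρ : Matrix (Fin d × Fin d × Fin d × Fin d) (Fin d × Fin d × Fin d × Fin d) ℂ) :
    Matrix (Fin d) (Fin d) ℂ :=
  Matrix.of fun l m => ∑ p : Fin d × Fin d × Fin d, ρ (p.1, p.2.1, p.2.2, l) (p.1, p.2.1, p.2.2, m)

/-- Splitting off the last of four parties. -/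
def splitLast (d : ℕ) :
    (Fin d × Fin d × Fin d) × Fin d ≃ Fin d × Fin d × Fin d × Fin d where
  toFun x := (x.1.1, x.1.2.1, x.1.2.2, x.2)
  invFun y := ((y.1, y.2.1, y.2.2.1), y.2.2.2)

theorem trace_mul_kron4_eq_sum
    (ρ : Matrix (Fin d × Fin d × Fin d × Fin d) (Fin d × Fin d × Fin d × Fin d) ℂ)
    (A B C D : Matrix (Fin d) (Fin d) ℂ) :
    (ρ * kron4 A B C D).trace = ∑ p : Fin d × Fin d × Fin d, ∑ l, ∑ q : Fin d × Fin d × Fin d, ∑ m,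
      ρ (p.1, p.2.1, p.2.2, l) (q.1, q.2.1, q.2.2, m) * ((A ⊗ₖ (B ⊗ₖ C)) q p * D m l) := by
  simp only [Matrix.trace, Matrix.diag_apply, Matrix.mul_apply]
  rw [← (splitLast d).sum_comp, Fintype.sum_prod_type]
  refine Finset.sum_congr rfl fun p _ => Finset.sum_congr rfl fun l _ => ?_
  rw [← (splitLast d).sum_comp, Fintype.sum_prod_type]
  refine Finset.sum_congr rfl fun q _ => Finset.sum_congr rfl fun m _ => ?_
  simp [splitLast, kron4, kroneckerMap_apply, mul_assoc]

theorem trace_mul_kron4_one_right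
    (ρ : Matrix (Fin d × Fin d × Fin d × Fin d) (Fin d × Fin d × Fin d × Fin d) ℂ)
    (A B C : Matrix (Fin d) (Fin d) ℂ) :
    (ρ * kron4 A B C 1).trace = (traceLast ρ * (A ⊗ₖ (B ⊗ₖ C))).trace := by
  rw [trace_mul_kron4_eq_sum, Matrix.trace]
  refine Finset.sum_congr rfl fun p _ => ?_
  rw [Finset.sum_comm, Matrix.diag_apply, Matrix.mul_apply]
  refine Finset.sum_congr rfl fun q _ => ?_
  simp [traceLast, Matrix.one_apply, Finset.sum_mul]

theorem trace_mul_kron4_one_left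
    (ρ : Matrix (Fin d × Fin d × Fin d × Fin d) (Fin d × Fin d × Fin d × Fin d) ℂ)
    (D : Matrix (Fin d) (Fin d) ℂ) :
    (ρ * kron4 1 1 1 D).trace = (traceInit ρ * D).trace := by
  rw [trace_mul_kron4_eq_sum, Finset.sum_comm, Matrix.trace]
  refine Finset.sum_congr rfl fun l _ => ?_
  rw [Matrix.diag_apply, Matrix.mul_apply]
  simp only [one_kronecker_one, Matrix.one_apply, traceInit, Matrix.of_apply, Finset.sum_mul]
  rw [Finset.sum_comm (s := (Finset.univ : Finset (Fin d)))]
  refine Finset.sum_congr rfl fun p _ => ?_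
  rw [Finset.sum_comm]
  simp

/-- The two complementary reductions of a pure state have the same purity. -/
theorem purity_traceLast_eq_traceInit
    {ρ : Matrix (Fin d × Fin d × Fin d × Fin d) (Fin d × Fin d × Fin d × Fin d) ℂ}
    (hherm : ρ.IsHermitian) (htr1 : ρ.trace = 1) (hpure : ρ * ρ = ρ) :
    ∑ p, ∑ q, traceLast ρ p q * star (traceLast ρ p q) =
      ∑ l, ∑ m, traceInit ρ l m * star (traceInit ρ l m) := by
  simp only [traceLast, traceInit, Matrix.of_apply, star_sum, hherm.apply, Finset.sum_mul_sum]
  calc _ = ∑ p : Fin d × Fin d × Fin d, ∑ q : Fin d × Fin d × Fin d, ∑ l, ∑ m,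
        ρ (p.1, p.2.1, p.2.2, l) (p.1, p.2.1, p.2.2, m) *
          ρ (q.1, q.2.1, q.2.2, m) (q.1, q.2.1, q.2.2, l) :=
        Finset.sum_congr rfl fun p _ => Finset.sum_congr rfl fun q _ =>
          Finset.sum_congr rfl fun l _ => Finset.sum_congr rfl fun m _ =>
            mul_apply_swap_of_pure hherm htr1 hpure _ _ _ _
    _ = _ := by
      simp only [← Fintype.sum_prod_type']
      refine Fintype.sum_equiv
        ⟨fun x => (x.2.2.1, x.2.2.2, x.1, x.2.1), fun x => (x.2.2.1, x.2.2.2, x.1, x.2.1),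
          fun _ => rfl, fun _ => rfl⟩ _ _ fun _ => rfl

theorem kron4_one : kron4 (1 : Matrix (Fin d) (Fin d) ℂ) 1 1 1 = 1 := by
  ext p q
  simp only [kron4, Matrix.of_apply, Matrix.one_apply, Prod.ext_iff, ← ite_and, mul_ite, mul_one,
    mul_zero]
  exact if_congr (by tauto) rfl rfl

theorem triple_sum_eq (hd : 2 ≤ d) {lam : Fin (d ^ 2 - 1) → Matrix (Fin d) (Fin d) ℂ}
    (hherm : ∀ i, (lam i).IsHermitian) (htr0 : ∀ i, (lam i).trace = 0)
    (horth : ∀ i j, (lam i * lam j).trace = if i = j then (d : ℂ) else 0)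
    {ρ : Matrix (Fin d × Fin d × Fin d × Fin d) (Fin d × Fin d × Fin d × Fin d) ℂ}
    (hρ : ρ.IsHermitian) (htr1 : ρ.trace = 1) (hpure : ρ * ρ = ρ) :
    1 + aSq lam ρ + bSq lam ρ + cSq lam ρ + RABsq lam ρ + RACsq lam ρ + RBCsq lam ρ +
      RABCsq lam ρ = (d : ℝ) ^ 2 * (1 + dSq lam ρ) := by
  have hG := isTightFamily_withOne hd hherm htr0 horth
  have h3 := (hG.kronecker (hG.kronecker hG)).sum_norm_trace_sq (traceLast ρ)
  have h1 := hG.sum_norm_trace_sq (traceInit ρ)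
  rw [purity_traceLast_eq_traceInit hρ htr1 hpure, mul_assoc, mul_left_comm, mul_assoc, ← h1] at h3
  have h4 : ((∑ x : Option (Fin (d ^ 2 - 1)) × Option (Fin (d ^ 2 - 1)) × Option (Fin (d ^ 2 - 1)),
      ‖(traceLast ρ * (withOne lam x.1 ⊗ₖ (withOne lam x.2.1 ⊗ₖ withOne lam x.2.2))).trace‖ ^ 2)
        : ℝ) = (d : ℝ) * (d * ∑ i, ‖(traceInit ρ * withOne lam i).trace‖ ^ 2) := by
    exact_mod_cast h3
  simp only [← trace_mul_kron4_one_right, ← trace_mul_kron4_one_left, Fintype.sum_prod_type,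
    Fintype.sum_option, withOne, Option.elim_none, Option.elim_some] at h4
  rw [kron4_one, mul_one, htr1] at h4
  simp only [Finset.sum_add_distrib, norm_one, one_pow] at h4
  rw [aSq, bSq, cSq, dSq, RABsq, RACsq, RBCsq, RABCsq]
  linarith

/-- Permuting the parties as `(A, B, C, D) ↦ (A, C, D, B)`. -/
def moveSecondLast (d : ℕ) :
    Fin d × Fin d × Fin d × Fin d ≃ Fin d × Fin d × Fin d × Fin d where
  toFun x := (x.1, x.2.2.2, x.2.1, x.2.2.1)
  invFun x := (x.1, x.2.2.1, x.2.2.2, x.2.1)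

/-- Permuting the parties as `(A, B, C, D) ↦ (B, C, D, A)`. -/
def moveFirstLast (d : ℕ) :
    Fin d × Fin d × Fin d × Fin d ≃ Fin d × Fin d × Fin d × Fin d where
  toFun x := (x.2.2.2, x.1, x.2.1, x.2.2.1)
  invFun x := (x.2.1, x.2.2.1, x.2.2.2, x.1)

/-- Permuting the parties as `(A, B, C, D) ↦ (A, B, D, C)`. -/
def moveThirdLast (d : ℕ) :
    Fin d × Fin d × Fin d × Fin d ≃ Fin d × Fin d × Fin d × Fin d where
  toFun x := (x.1, x.2.1, x.2.2.2, x.2.2.1)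
  invFun x := (x.1, x.2.1, x.2.2.2, x.2.2.1)

theorem trace_submatrix_mul {n : Type*} [Fintype n] (e : n ≃ n) (ρ K L : Matrix n n ℂ)
    (h : K = L.submatrix e e) : (ρ.submatrix e e * K).trace = (ρ * L).trace := by
  rw [h, Matrix.submatrix_mul_equiv]
  exact e.sum_comp fun i => (ρ * L) i i

theorem trace_moveSecondLast
    (ρ : Matrix (Fin d × Fin d × Fin d × Fin d) (Fin d × Fin d × Fin d × Fin d) ℂ)
    (A B C D : Matrix (Fin d) (Fin d) ℂ) :
    (ρ.submatrix (moveSecondLast d) (moveSecondLast d) * kron4 A B C D).trace =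
      (ρ * kron4 A D B C).trace := by
  refine trace_submatrix_mul _ _ _ _ ?_
  ext p q
  simp only [kron4, moveSecondLast, Matrix.of_apply, Matrix.submatrix_apply, Equiv.coe_fn_mk]
  ring

theorem trace_moveFirstLast
    (ρ : Matrix (Fin d × Fin d × Fin d × Fin d) (Fin d × Fin d × Fin d × Fin d) ℂ)
    (A B C D : Matrix (Fin d) (Fin d) ℂ) :
    (ρ.submatrix (moveFirstLast d) (moveFirstLast d) * kron4 A B C D).trace =
      (ρ * kron4 D A B C).trace := by
  refine trace_submatrix_mul _ _ _ _ ?_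
  ext p q
  simp only [kron4, moveFirstLast, Matrix.of_apply, Matrix.submatrix_apply, Equiv.coe_fn_mk]
  ring

theorem trace_moveThirdLast
    (ρ : Matrix (Fin d × Fin d × Fin d × Fin d) (Fin d × Fin d × Fin d × Fin d) ℂ)
    (A B C D : Matrix (Fin d) (Fin d) ℂ) :
    (ρ.submatrix (moveThirdLast d) (moveThirdLast d) * kron4 A B C D).trace =
      (ρ * kron4 A B D C).trace := by
  refine trace_submatrix_mul _ _ _ _ ?_
  ext p q
  simp only [kron4, moveThirdLast, Matrix.of_apply, Matrix.submatrix_apply, Equiv.coe_fn_mk]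
  ring

/-- For a pure quadripartite qudit state, the sum of the isotropic strengths of the
three pairs inside each triple of parties (Eq. (16) of the paper). -/
theorem triple_pair_strength_sums (d : ℕ) (hd : 2 ≤ d)
    (lam : Fin (d ^ 2 - 1) → Matrix (Fin d) (Fin d) ℂ)
    (hherm : ∀ i, (lam i).IsHermitian)
    (htr0 : ∀ i, (lam i).trace = 0)
    (horth : ∀ i j, (lam i * lam j).trace = if i = j then (d : ℂ) else 0)
    (ρ : Matrix (Fin d × Fin d × Fin d × Fin d) (Fin d × Fin d × Fin d × Fin d) ℂ)
    (hpsd : ρ.PosSemidef) (htr1 : ρ.trace = 1) (hpure : ρ * ρ = ρ) :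
    sBC lam ρ + sAC lam ρ + sAB lam ρ =
        ((d : ℝ) ^ 2 * (1 + dSq lam ρ) - (1 + aSq lam ρ + bSq lam ρ + cSq lam ρ) -
          RABCsq lam ρ) / ((d : ℝ) ^ 2 - 1) ∧
    sCD lam ρ + sAC lam ρ + sAD lam ρ =
        ((d : ℝ) ^ 2 * (1 + bSq lam ρ) - (1 + aSq lam ρ + cSq lam ρ + dSq lam ρ) -
          RACDsq lam ρ) / ((d : ℝ) ^ 2 - 1) ∧
    sBC lam ρ + sCD lam ρ + sBD lam ρ =
        ((d : ℝ) ^ 2 * (1 + aSq lam ρ) - (1 + bSq lam ρ + cSq lam ρ + dSq lam ρ) -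
          RBCDsq lam ρ) / ((d : ℝ) ^ 2 - 1) ∧
    sAB lam ρ + sAD lam ρ + sBD lam ρ =
        ((d : ℝ) ^ 2 * (1 + cSq lam ρ) - (1 + aSq lam ρ + bSq lam ρ + dSq lam ρ) -
          RABDsq lam ρ) / ((d : ℝ) ^ 2 - 1) := by
  have hρ := hpsd.isHermitian
  have main : ∀ e : Fin d × Fin d × Fin d × Fin d ≃ Fin d × Fin d × Fin d × Fin d, _ := fun e =>
    triple_sum_eq hd hherm htr0 horth (ρ := ρ.submatrix e e) (hρ.submatrix e)
      ((e.sum_comp fun i => ρ i i).trans htr1)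
      (by rw [Matrix.submatrix_mul_equiv, hpure])
  have hABC := triple_sum_eq hd hherm htr0 horth hρ htr1 hpure
  have hACD := main (moveSecondLast d)
  have hBCD := main (moveFirstLast d)
  have hABD := main (moveThirdLast d)
  simp only [aSq, bSq, cSq, dSq, RABsq, RACsq, RBCsq, RABCsq, trace_moveSecondLast,
    trace_moveFirstLast, trace_moveThirdLast] at hABC hACD hBCD hABD
  simp only [sAB, sAC, sAD, sBC, sBD, sCD, ← add_div]
  simp only [aSq, bSq, cSq, dSq, RABsq, RACsq, RADsq, RBCsq, RBDsq, RCDsq, RABCsq, RABDsq,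
    RACDsq, RBCDsq]
  refine ⟨?_, ?_, ?_, ?_⟩ <;> congr 1 <;> linarith

end SpinCorr4
end

section
/- Let ρ be a pure quadripartite qudit state on ℂ^d ⊗ ℂ^d ⊗ ℂ^d ⊗ ℂ^d. Then the four quantities pairing each single-party Bloch vector with the three-body correlation strength of the complementary triple coincide: (d²−1)‖a‖² − ‖R^{BCD}‖² = (d²−1)‖b‖² − ‖R^{ACD}‖² = (d²−1)‖c‖² − ‖R^{ABD}‖² = (d²−1)‖d‖² − ‖R^{ABC}‖². -/
open Matrix ComplexOrder

namespace SpinCorr4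

variable {d : ℕ}

variable (lam : Fin (d ^ 2 - 1) → Matrix (Fin d) (Fin d) ℂ)
variable (ρ : Matrix (Fin d × Fin d × Fin d × Fin d) (Fin d × Fin d × Fin d × Fin d) ℂ)

/-- The two-by-two minors of an idempotent matrix of trace one vanish. -/
theorem mul_apply_swap_of_idempotent_of_trace_eq_one {n : Type*} [Fintype n] [DecidableEq n]
    {P : Matrix n n ℂ} (hP : P * P = P) (htr : P.trace = 1) (i j k l : n) :
    P i j * P l k = P l j * P i k := by
  have hid : IsIdempotentElem (Matrix.toLin' P) := by
    rw [IsIdempotentElem, Module.End.mul_eq_comp, ← Matrix.toLin'_mul, hP]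
  have hrank : Module.finrank ℂ (LinearMap.range (Matrix.toLin' P)) = 1 := by
    have h := (LinearMap.IsIdempotentElem.isProj_range _ hid).trace
    rw [Matrix.trace_toLin'_eq, htr] at h
    exact_mod_cast h.symm
  obtain ⟨v, -, hv⟩ := finrank_eq_one_iff'.mp hrank
  have hcol : ∀ j, ∃ c : ℂ, ∀ i, P i j = c * (v : n → ℂ) i := fun j => by
    obtain ⟨c, hc⟩ := hv ⟨Matrix.toLin' P (Pi.single j 1), LinearMap.mem_range_self _ _⟩
    refine ⟨c, fun i => ?_⟩
    have h := congrFun (congrArg Subtype.val hc) i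
    simpa using h.symm
  choose c hc using hcol
  simp only [hc]
  ring

/-- Completeness relation: `d²` pairwise orthogonal matrices of squared norm `d`, one of them the
identity, resolve the identity of the space of `d × d` matrices. -/
theorem sum_mul_star_eq (hd : 2 ≤ d) {lam : Fin (d ^ 2 - 1) → Matrix (Fin d) (Fin d) ℂ}
    (hherm : ∀ i, (lam i).IsHermitian) (htr0 : ∀ i, (lam i).trace = 0)
    (horth : ∀ i j, (lam i * lam j).trace = if i = j then (d : ℂ) else 0)
    (p q r s : Fin d) :
    ∑ i, lam i p q * star (lam i r s) =
      d * ((1 : Matrix (Fin d) (Fin d) ℂ) p r * (1 : Matrix (Fin d) (Fin d) ℂ) q s)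
        - (1 : Matrix (Fin d) (Fin d) ℂ) p q * (1 : Matrix (Fin d) (Fin d) ℂ) r s := by
  have hd0 : (d : ℂ) ≠ 0 := by
    have : d ≠ 0 := by omega
    exact_mod_cast this
  let e : Option (Fin (d ^ 2 - 1)) → Matrix (Fin d) (Fin d) ℂ := fun i => i.elim 1 lam
  have heherm : ∀ i, (e i).IsHermitian := by
    rintro (_ | i)
    · exact Matrix.isHermitian_one
    · exact hherm i
  have heorth : ∀ i j, (e i * e j).trace = if i = j then (d : ℂ) else 0 := by
    rintro (_ | i) (_ | j) <;> simp [e, htr0, horth]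
  let U : Matrix (Option (Fin (d ^ 2 - 1))) (Fin d × Fin d) ℂ := Matrix.of fun i x => e i x.1 x.2
  have hcard : Fintype.card (Option (Fin (d ^ 2 - 1))) = Fintype.card (Fin d × Fin d) := by
    have : 0 < d ^ 2 := by positivity
    simp only [Fintype.card_option, Fintype.card_fin, Fintype.card_prod]
    rw [Nat.sub_add_cancel this, sq]
  have hU : U * ((d : ℂ)⁻¹ • Uᴴ) = 1 := by
    ext i j
    have h := heorth i j
    rw [← (heherm j).eq] at h
    simp only [Matrix.trace, Matrix.diag, Matrix.mul_apply, Matrix.conjTranspose_apply] at h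
    rw [Matrix.mul_smul, Matrix.smul_apply, Matrix.mul_apply, Fintype.sum_prod_type]
    simp only [U, Matrix.conjTranspose_apply, Matrix.of_apply]
    rw [h, Matrix.one_apply]
    split_ifs <;> simp [hd0]
  have hU' := (Matrix.mul_eq_one_comm_of_card_eq _ _ _ hcard).mp hU
  have h := congrFun (congrFun hU' (r, s)) (p, q)
  rw [Matrix.smul_mul, Matrix.smul_apply, Matrix.mul_apply, Fintype.sum_option] at h
  simp only [U, e, Matrix.conjTranspose_apply, Matrix.of_apply, Option.elim, smul_eq_mul] at h
  rw [inv_mul_eq_iff_eq_mul₀ hd0] at h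
  have hstar : star ((1 : Matrix (Fin d) (Fin d) ℂ) r s) = (1 : Matrix (Fin d) (Fin d) ℂ) r s := by
    simp only [Matrix.one_apply]
    split_ifs <;> simp
  have hprod : (1 : Matrix (Fin d × Fin d) (Fin d × Fin d) ℂ) (r, s) (p, q) =
      (1 : Matrix (Fin d) (Fin d) ℂ) p r * (1 : Matrix (Fin d) (Fin d) ℂ) q s := by
    simp only [Matrix.one_apply, Prod.mk.injEq, eq_comm (a := r), eq_comm (a := s)]
    split_ifs <;> simp_all
  rw [hstar, hprod] at h
  rw [← h, Finset.sum_congr rfl fun i _ => mul_comm (lam i p q) (star (lam i r s))]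
  ring

/-- Quadruples of multi-indices of the four-party space. -/
abbrev Idx4 (d : ℕ) : Type :=
  (Fin d × Fin d × Fin d × Fin d) × (Fin d × Fin d × Fin d × Fin d) ×
    (Fin d × Fin d × Fin d × Fin d) × (Fin d × Fin d × Fin d × Fin d)

/-- The contraction of a kernel `F` with two copies of `ρ`. -/
noncomputable def contract
    (ρ : Matrix (Fin d × Fin d × Fin d × Fin d) (Fin d × Fin d × Fin d × Fin d) ℂ)
    (F : Idx4 d → ℂ) : ℂ :=
  ∑ x, ρ x.1 x.2.1 * ρ x.2.2.2 x.2.2.1 * F x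

theorem contract_sub (F G : Idx4 d → ℂ) :
    contract ρ (fun x => F x - G x) = contract ρ F - contract ρ G := by
  simp only [contract, mul_sub, Finset.sum_sub_distrib]

theorem contract_const_mul (a : ℂ) (F : Idx4 d → ℂ) :
    contract ρ (fun x => a * F x) = a * contract ρ F := by
  simp only [contract, Finset.mul_sum]
  exact Finset.sum_congr rfl fun _ _ => by ring

/-- For a rank-one projection, a kernel antisymmetric under exchange of the two row indices has
vanishing contraction. -/
theorem contract_eq_zero_of_antisymm {ρ} (hpure : ρ * ρ = ρ) (htr : ρ.trace = 1)
    {F : Idx4 d → ℂ} (hF : ∀ i j k l, F (l, j, k, i) = -F (i, j, k, l)) :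
    contract ρ F = 0 := by
  let σ : Equiv.Perm (Idx4 d) :=
    Function.Involutive.toPerm (fun x => (x.2.2.2, x.2.1, x.2.2.1, x.1)) fun _ => rfl
  have h : contract ρ F = -contract ρ F := by
    conv_lhs => rw [contract, ← Equiv.sum_comp σ]
    rw [contract, ← Finset.sum_neg_distrib]
    refine Finset.sum_congr rfl fun ⟨i, j, k, l⟩ _ => ?_
    change ρ l j * ρ i k * F (l, j, k, i) = -(ρ i j * ρ l k * F (i, j, k, l))
    rw [hF, mul_apply_swap_of_idempotent_of_trace_eq_one hpure htr i j k l]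
    ring
  linear_combination h / 2

/-- The squared norm of a family of expectation values as a contraction with two copies of `ρ`. -/
theorem sum_norm_sq_trace_kron4 {ρ} (hρ : ρ.IsHermitian) {α β γ δ : Type*}
    [Fintype α] [Fintype β] [Fintype γ] [Fintype δ]
    (A : α → Matrix (Fin d) (Fin d) ℂ) (B : β → Matrix (Fin d) (Fin d) ℂ)
    (C : γ → Matrix (Fin d) (Fin d) ℂ) (D : δ → Matrix (Fin d) (Fin d) ℂ) :
    ((∑ a, ∑ b, ∑ c, ∑ e, ‖(ρ * kron4 (A a) (B b) (C c) (D e)).trace‖ ^ 2 : ℝ) : ℂ) =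
      contract ρ fun x =>
        (∑ a, A a x.2.1.1 x.1.1 * star (A a x.2.2.2.1 x.2.2.1.1)) *
        (∑ b, B b x.2.1.2.1 x.1.2.1 * star (B b x.2.2.2.2.1 x.2.2.1.2.1)) *
        (∑ c, C c x.2.1.2.2.1 x.1.2.2.1 * star (C c x.2.2.2.2.2.1 x.2.2.1.2.2.1)) *
        (∑ e, D e x.2.1.2.2.2 x.1.2.2.2 * star (D e x.2.2.2.2.2.2 x.2.2.1.2.2.2)) := by
  have key : ∀ a b c e, ((‖(ρ * kron4 (A a) (B b) (C c) (D e)).trace‖ ^ 2 : ℝ) : ℂ) =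
      ∑ x : Idx4 d, ρ x.1 x.2.1 * ρ x.2.2.2 x.2.2.1 *
        ((A a x.2.1.1 x.1.1 * star (A a x.2.2.2.1 x.2.2.1.1)) *
        (B b x.2.1.2.1 x.1.2.1 * star (B b x.2.2.2.2.1 x.2.2.1.2.1)) *
        (C c x.2.1.2.2.1 x.1.2.2.1 * star (C c x.2.2.2.2.2.1 x.2.2.1.2.2.1)) *
        (D e x.2.1.2.2.2 x.1.2.2.2 * star (D e x.2.2.2.2.2.2 x.2.2.1.2.2.2))) := by
    intro a b c e
    rw [Complex.ofReal_pow, ← Complex.conj_mul']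
    simp only [Idx4, Fintype.sum_prod_type (α₁ := Fin d × Fin d × Fin d × Fin d), Matrix.trace,
      Matrix.diag, Matrix.mul_apply, map_sum, Finset.sum_mul, Finset.mul_sum]
    refine Finset.sum_congr rfl fun i _ => Finset.sum_congr rfl fun j _ =>
      Finset.sum_congr rfl fun k _ => Finset.sum_congr rfl fun l _ => ?_
    rw [← hρ.apply l k]
    simp only [kron4, Matrix.of_apply, map_mul, starRingEnd_apply]
    ring
  simp only [Complex.ofReal_sum, key, contract]
  simp only [Finset.sum_comm (t := (Finset.univ : Finset (Idx4 d)))]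
  refine Finset.sum_congr rfl fun x _ => ?_
  simp only [← Finset.mul_sum, ← Finset.sum_mul]

/-- For a pure quadripartite qudit state, the four quantities pairing each single-party
Bloch vector with the three-body correlation strength of the complementary triple
coincide (Eq. (17) of the paper). -/
theorem bloch_complementary_triple_identity (d : ℕ) (hd : 2 ≤ d)
    (lam : Fin (d ^ 2 - 1) → Matrix (Fin d) (Fin d) ℂ)
    (hherm : ∀ i, (lam i).IsHermitian)
    (htr0 : ∀ i, (lam i).trace = 0)
    (horth : ∀ i j, (lam i * lam j).trace = if i = j then (d : ℂ) else 0)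
    (ρ : Matrix (Fin d × Fin d × Fin d × Fin d) (Fin d × Fin d × Fin d × Fin d) ℂ)
    (hpsd : ρ.PosSemidef) (htr1 : ρ.trace = 1) (hpure : ρ * ρ = ρ) :
    ((d : ℝ) ^ 2 - 1) * aSq lam ρ - RBCDsq lam ρ =
        ((d : ℝ) ^ 2 - 1) * bSq lam ρ - RACDsq lam ρ ∧
    ((d : ℝ) ^ 2 - 1) * bSq lam ρ - RACDsq lam ρ =
        ((d : ℝ) ^ 2 - 1) * cSq lam ρ - RABDsq lam ρ ∧
    ((d : ℝ) ^ 2 - 1) * cSq lam ρ - RABDsq lam ρ =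
        ((d : ℝ) ^ 2 - 1) * dSq lam ρ - RABCsq lam ρ := by
  have hu : ∀ p q : Fin d, star ((1 : Matrix (Fin d) (Fin d) ℂ) p q) =
      (1 : Matrix (Fin d) (Fin d) ℂ) p q := fun p q => by
    simp only [Matrix.one_apply]
    split_ifs <;> simp
  have hc := sum_mul_star_eq hd hherm htr0 horth
  have hN := hpsd.isHermitian
  let one : Unit → Matrix (Fin d) (Fin d) ℂ := fun _ => 1
  have ha := sum_norm_sq_trace_kron4 hN lam one one one
  have hb := sum_norm_sq_trace_kron4 hN one lam one one
  have hcc := sum_norm_sq_trace_kron4 hN one one lam one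
  have hdd := sum_norm_sq_trace_kron4 hN one one one lam
  have hbcd := sum_norm_sq_trace_kron4 hN one lam lam lam
  have hacd := sum_norm_sq_trace_kron4 hN lam one lam lam
  have habd := sum_norm_sq_trace_kron4 hN lam lam one lam
  have habc := sum_norm_sq_trace_kron4 hN lam lam lam one
  simp only [one, Finset.univ_unique, Finset.sum_singleton, hc, hu]
    at ha hb hcc hdd hbcd hacd habd habc
  have complex_eq : ∀ {x y z w : ℝ} {X Y Z W : Idx4 d → ℂ}, (x : ℂ) = contract ρ X →
      (y : ℂ) = contract ρ Y → (z : ℂ) = contract ρ Z → (w : ℂ) = contract ρ W →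
      (∀ i j k l,
        ((d : ℂ) ^ 2 - 1) * X (l, j, k, i) - Y (l, j, k, i)
          - (((d : ℂ) ^ 2 - 1) * Z (l, j, k, i) - W (l, j, k, i)) =
        -(((d : ℂ) ^ 2 - 1) * X (i, j, k, l) - Y (i, j, k, l)
          - (((d : ℂ) ^ 2 - 1) * Z (i, j, k, l) - W (i, j, k, l)))) →
      ((d : ℝ) ^ 2 - 1) * x - y = ((d : ℝ) ^ 2 - 1) * z - w := by
    intro x y z w X Y Z W hx hy hz hw hF
    have h := contract_eq_zero_of_antisymm hpure htr1
      (F := fun t => (((d : ℂ) ^ 2 - 1) * X t - Y t) - (((d : ℂ) ^ 2 - 1) * Z t - W t)) hF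
    simp only [contract_sub, contract_const_mul, ← hx, ← hy, ← hz, ← hw] at h
    rw [sub_eq_zero] at h
    exact_mod_cast h
  refine ⟨complex_eq ha hbcd hb hacd ?_, complex_eq hb hacd hcc habd ?_,
    complex_eq hcc habd hdd habc ?_⟩ <;>
  · intro i j k l
    ring

end SpinCorr4
end

section
/- (Corollary 3.3, monogamy relation) Let ρ be a pure quadripartite qudit state on ℂ^d ⊗ ℂ^d ⊗ ℂ^d ⊗ ℂ^d. Then, with party A as the central particle, s_iso^{AB} + s_iso^{AC} + s_iso^{AD} = (d²−1 + (d²−3)‖a‖² − ‖R^{BCD}‖²)/(d²−1). -/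
open Matrix ComplexOrder

namespace SpinCorr4

variable {d : ℕ}

variable (lam : Fin (d ^ 2 - 1) → Matrix (Fin d) (Fin d) ℂ)
variable (ρ : Matrix (Fin d × Fin d × Fin d × Fin d) (Fin d × Fin d × Fin d × Fin d) ℂ)

/-- The minors of order two of an idempotent matrix of trace one vanish. -/
theorem mul_apply_swap_of_idempotent {n : Type*} [Fintype n] [DecidableEq n]
    {P : Matrix n n ℂ} (hP : P * P = P) (htr : P.trace = 1) (p q r s : n) :
    P p q * P r s = P p s * P r q := by
  have hidem : IsIdempotentElem (Matrix.toLin' P) := by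
    rw [IsIdempotentElem, Module.End.mul_eq_comp, ← Matrix.toLin'_mul, hP]
  have hproj := LinearMap.IsIdempotentElem.isProj_range _ hidem
  have hrank : Module.finrank ℂ (LinearMap.range (Matrix.toLin' P)) = 1 := by
    have h := hproj.trace
    rw [Matrix.trace_toLin'_eq, htr] at h
    exact_mod_cast h.symm
  obtain ⟨v, -, hv⟩ := finrank_eq_one_iff'.mp hrank
  have hcol : ∀ j, ∃ c : ℂ, ∀ i, P i j = c * v.1 i := by
    intro j
    obtain ⟨c, hc⟩ := hv ⟨_, LinearMap.mem_range_self (Matrix.toLin' P) (Pi.single j 1)⟩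
    refine ⟨c, fun i => ?_⟩
    have h := congrFun (congrArg Subtype.val hc) i
    simpa using h.symm
  choose c hc using hcol
  simp only [hc]
  ring

/-- The kernel `(x, y, z, w) ↦ ∑ i, lam i y x * lam i w z` of `∑ i, lam i ⊗ lam i`. -/
noncomputable def lamKernel (x y z w : Fin d) : ℂ := ∑ i, lam i y x * lam i w z

/-- The kernel of the identity of `ℂ^d ⊗ ℂ^d`. -/
def idKernel (x y z w : Fin d) : ℂ :=
  (1 : Matrix (Fin d) (Fin d) ℂ) y x * (1 : Matrix (Fin d) (Fin d) ℂ) w z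

/-- The kernel of the swap operator of `ℂ^d ⊗ ℂ^d`. -/
def swapKernel (x y z w : Fin d) : ℂ := idKernel x w z y

/-- Completeness relation: `1 ⊗ 1 + ∑ i, lam i ⊗ lam i` is `d` times the swap operator. -/
theorem lamKernel_eq (hd : 2 ≤ d) (htr0 : ∀ i, (lam i).trace = 0)
    (horth : ∀ i j, (lam i * lam j).trace = if i = j then (d : ℂ) else 0)
    (x y z w : Fin d) :
    lamKernel lam x y z w = d * swapKernel x y z w - idKernel x y z w := by
  have hd0 : (d : ℂ) ≠ 0 := by
    have : d ≠ 0 := by omega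
    exact_mod_cast this
  let μ : Option (Fin (d ^ 2 - 1)) → Matrix (Fin d) (Fin d) ℂ := fun k => k.elim 1 lam
  have hμ : ∀ k l, (μ k * μ l).trace = if k = l then (d : ℂ) else 0 := by
    rintro (_ | k) (_ | l) <;> simp [μ, htr0, horth]
  let M : Matrix (Option (Fin (d ^ 2 - 1))) (Fin d × Fin d) ℂ :=
    Matrix.of fun k u => (d : ℂ)⁻¹ * μ k u.1 u.2
  let N : Matrix (Fin d × Fin d) (Option (Fin (d ^ 2 - 1))) ℂ :=
    Matrix.of fun u k => μ k u.2 u.1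
  have hMN : M * N = 1 := by
    ext k l
    have h := hμ k l
    simp only [Matrix.trace, Matrix.diag, Matrix.mul_apply] at h
    simp only [M, N, Matrix.mul_apply, Matrix.of_apply, Fintype.sum_prod_type, mul_assoc,
      ← Finset.mul_sum, h, Matrix.one_apply]
    split_ifs <;> simp [hd0]
  have hcard : Fintype.card (Option (Fin (d ^ 2 - 1))) = Fintype.card (Fin d × Fin d) := by
    have : 0 < d ^ 2 := by positivity
    simp only [Fintype.card_option, Fintype.card_fin, Fintype.card_prod]
    rw [← sq]
    omega
  have hNM := (Matrix.mul_eq_one_comm_of_card_eq _ _ _ hcard).mp hMN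
  have h := congrFun (congrFun hNM (x, y)) (w, z)
  simp only [M, N, μ, Matrix.mul_apply, Matrix.of_apply, Fintype.sum_option, Option.elim,
    mul_left_comm _ (d : ℂ)⁻¹, ← Finset.mul_sum] at h
  rw [inv_mul_eq_iff_eq_mul₀ hd0] at h
  have hswap : (1 : Matrix (Fin d × Fin d) (Fin d × Fin d) ℂ) (x, y) (w, z) =
      swapKernel x y z w := by
    simp only [swapKernel, idKernel, Matrix.one_apply, Prod.mk.injEq, eq_comm (a := w),
      ite_and]
    split_ifs <;> simp
  rw [hswap] at h
  rw [← h]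
  simp [lamKernel, idKernel]

/-- The kernel of a tensor product of four operators on `ℂ^d ⊗ ℂ^d`. -/
def kernel4 (X₁ X₂ X₃ X₄ : Fin d → Fin d → Fin d → Fin d → ℂ)
    (p q r s : Fin d × Fin d × Fin d × Fin d) : ℂ :=
  X₁ p.1 q.1 r.1 s.1 * X₂ p.2.1 q.2.1 r.2.1 s.2.1 *
    X₃ p.2.2.1 q.2.2.1 r.2.2.1 s.2.2.1 * X₄ p.2.2.2 q.2.2.2 r.2.2.2 s.2.2.2

/-- The linear functional pairing `P ⊗ P` with a kernel. -/
noncomputable def pairing {n : Type*} [Fintype n] (P : Matrix n n ℂ) :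
    (n → n → n → n → ℂ) →ₗ[ℂ] ℂ where
  toFun K := ∑ p, ∑ q, ∑ r, ∑ s, P p q * P r s * K p q r s
  map_add' K L := by simp only [Pi.add_apply, mul_add, Finset.sum_add_distrib]
  map_smul' c K := by
    simp only [Pi.smul_apply, smul_eq_mul, mul_left_comm _ c, Finset.mul_sum, RingHom.id_apply]

theorem pairing_apply {n : Type*} [Fintype n] (P : Matrix n n ℂ) (K : n → n → n → n → ℂ) :
    pairing P K = ∑ p, ∑ q, ∑ r, ∑ s, P p q * P r s * K p q r s := rfl

theorem pairing_mul {n : Type*} [Fintype n] (P A : Matrix n n ℂ) :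
    pairing P (fun p q r s => A q p * A s r) = (P * A).trace ^ 2 := by
  simp only [pairing_apply, sq, Matrix.trace, Matrix.diag, Matrix.mul_apply]
  simp only [Finset.sum_mul_sum]
  refine Finset.sum_congr rfl fun p _ => ?_
  rw [Finset.sum_comm]
  refine Finset.sum_congr rfl fun q _ => Finset.sum_congr rfl fun r _ =>
    Finset.sum_congr rfl fun s _ => ?_
  ring

/-- On an idempotent of trace one, the pairing is unchanged by exchanging the two columns. -/
theorem pairing_swap {n : Type*} [Fintype n] [DecidableEq n] {P : Matrix n n ℂ}
    (hP : P * P = P) (htr : P.trace = 1) (K : n → n → n → n → ℂ) :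
    pairing P (fun p q r s => K p s r q) = pairing P K := by
  simp only [pairing_apply]
  refine Finset.sum_congr rfl fun p _ => ?_
  rw [Finset.sum_comm]
  conv_rhs => rw [Finset.sum_comm]
  refine Finset.sum_congr rfl fun r _ => ?_
  rw [Finset.sum_comm]
  refine Finset.sum_congr rfl fun q _ => Finset.sum_congr rfl fun s _ => ?_
  rw [mul_apply_swap_of_idempotent hP htr]

theorem trace_mul_kron4_sq (A B C D : Matrix (Fin d) (Fin d) ℂ)
    (hρ : ρ.IsHermitian) (hA : A.IsHermitian) (hB : B.IsHermitian) (hC : C.IsHermitian)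
    (hD : D.IsHermitian) :
    ((‖(ρ * kron4 A B C D).trace‖ ^ 2 : ℝ) : ℂ) =
      pairing ρ (kernel4 (fun x y z w => A y x * A w z) (fun x y z w => B y x * B w z)
        (fun x y z w => C y x * C w z) (fun x y z w => D y x * D w z)) := by
  have hK : (kron4 A B C D).IsHermitian := by
    ext p q
    simp [kron4, ← hA.apply p.1 q.1, ← hB.apply p.2.1 q.2.1, ← hC.apply p.2.2.1 q.2.2.1,
      ← hD.apply p.2.2.2 q.2.2.2]
  have hreal : star (ρ * kron4 A B C D).trace = (ρ * kron4 A B C D).trace := by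
    rw [← Matrix.trace_conjTranspose, Matrix.conjTranspose_mul, hK.eq, hρ.eq,
      Matrix.trace_mul_comm]
  have hsq : ((‖(ρ * kron4 A B C D).trace‖ ^ 2 : ℝ) : ℂ) = (ρ * kron4 A B C D).trace ^ 2 := by
    rw [Complex.ofReal_pow, ← Complex.mul_conj', sq]
    congr 1
  rw [hsq, ← pairing_mul]
  congr 1
  ext p q r s
  simp only [kernel4, kron4, Matrix.of_apply]
  ring

theorem aSq_eq_pairing (hherm : ∀ i, (lam i).IsHermitian) (hρ : ρ.IsHermitian) :
    ((aSq lam ρ : ℝ) : ℂ) = pairing ρ (kernel4 (lamKernel lam) idKernel idKernel idKernel) := by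
  simp only [aSq, Complex.ofReal_sum,
    trace_mul_kron4_sq ρ _ _ _ _ hρ
      (hherm _) isHermitian_one isHermitian_one isHermitian_one, ← map_sum]
  congr 1
  ext p q r s
  simp only [Finset.sum_apply, kernel4, lamKernel, idKernel, mul_assoc]
  simp only [Finset.sum_mul, mul_assoc]

theorem RABsq_eq_pairing (hherm : ∀ i, (lam i).IsHermitian) (hρ : ρ.IsHermitian) :
    ((RABsq lam ρ : ℝ) : ℂ) =
      pairing ρ (kernel4 (lamKernel lam) (lamKernel lam) idKernel idKernel) := by
  simp only [RABsq, Complex.ofReal_sum,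
    trace_mul_kron4_sq ρ _ _ _ _ hρ
      (hherm _) (hherm _) isHermitian_one isHermitian_one, ← map_sum]
  congr 1
  ext p q r s
  simp only [Finset.sum_apply, kernel4, lamKernel, idKernel, mul_assoc]
  simp only [Finset.sum_mul, mul_assoc]
  simp only [Finset.mul_sum]

theorem RACsq_eq_pairing (hherm : ∀ i, (lam i).IsHermitian) (hρ : ρ.IsHermitian) :
    ((RACsq lam ρ : ℝ) : ℂ) =
      pairing ρ (kernel4 (lamKernel lam) idKernel (lamKernel lam) idKernel) := by
  simp only [RACsq, Complex.ofReal_sum,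
    trace_mul_kron4_sq ρ _ _ _ _ hρ
      (hherm _) isHermitian_one (hherm _) isHermitian_one, ← map_sum]
  congr 1
  ext p q r s
  simp only [Finset.sum_apply, kernel4, lamKernel, idKernel, mul_assoc]
  simp only [Finset.sum_mul, mul_assoc]
  simp only [Finset.mul_sum]

theorem RADsq_eq_pairing (hherm : ∀ i, (lam i).IsHermitian) (hρ : ρ.IsHermitian) :
    ((RADsq lam ρ : ℝ) : ℂ) =
      pairing ρ (kernel4 (lamKernel lam) idKernel idKernel (lamKernel lam)) := by
  simp only [RADsq, Complex.ofReal_sum,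
    trace_mul_kron4_sq ρ _ _ _ _ hρ
      (hherm _) isHermitian_one isHermitian_one (hherm _), ← map_sum]
  congr 1
  ext p q r s
  simp only [Finset.sum_apply, kernel4, lamKernel, idKernel, mul_assoc]
  simp only [Finset.sum_mul, mul_assoc]
  simp only [Finset.mul_sum]

theorem RBCDsq_eq_pairing (hherm : ∀ i, (lam i).IsHermitian) (hρ : ρ.IsHermitian) :
    ((RBCDsq lam ρ : ℝ) : ℂ) =
      pairing ρ (kernel4 idKernel (lamKernel lam) (lamKernel lam) (lamKernel lam)) := by
  simp only [RBCDsq, Complex.ofReal_sum,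
    trace_mul_kron4_sq ρ _ _ _ _ hρ
      isHermitian_one (hherm _) (hherm _) (hherm _), ← map_sum]
  congr 1
  ext p q r s
  simp only [Finset.sum_apply, kernel4, lamKernel, idKernel, mul_assoc]
  simp only [Finset.sum_mul, mul_assoc]
  simp only [Finset.mul_sum]

theorem pairing_idKernel (htr : ρ.trace = 1) :
    pairing ρ (kernel4 idKernel idKernel idKernel idKernel) = 1 := by
  have h := pairing_mul ρ 1
  rw [mul_one, htr, one_pow] at h
  rw [← h]
  congr 1
  ext ⟨p₁, p₂, p₃, p₄⟩ ⟨q₁, q₂, q₃, q₄⟩ ⟨r₁, r₂, r₃, r₄⟩ ⟨s₁, s₂, s₃, s₄⟩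
  simp only [kernel4, idKernel, Matrix.one_apply, Prod.mk.injEq, ite_and]
  split_ifs <;> simp

/-- Complementary subsystems of a pure state have equal purities, in terms of kernels. -/
theorem pairing_kernel4_swap (hP : ρ * ρ = ρ) (htr : ρ.trace = 1)
    (X₁ X₂ X₃ X₄ : Fin d → Fin d → Fin d → Fin d → ℂ) :
    pairing ρ (kernel4 (fun x y z w => X₁ x w z y) (fun x y z w => X₂ x w z y)
      (fun x y z w => X₃ x w z y) (fun x y z w => X₄ x w z y)) =
      pairing ρ (kernel4 X₁ X₂ X₃ X₄) :=
  pairing_swap hP htr (kernel4 X₁ X₂ X₃ X₄)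

/-- Corollary 3.3: monogamy relation with party A as the central particle. -/
theorem monogamy_relation_central_A (d : ℕ) (hd : 2 ≤ d)
    (lam : Fin (d ^ 2 - 1) → Matrix (Fin d) (Fin d) ℂ)
    (hherm : ∀ i, (lam i).IsHermitian)
    (htr0 : ∀ i, (lam i).trace = 0)
    (horth : ∀ i j, (lam i * lam j).trace = if i = j then (d : ℂ) else 0)
    (ρ : Matrix (Fin d × Fin d × Fin d × Fin d) (Fin d × Fin d × Fin d × Fin d) ℂ)
    (hpsd : ρ.PosSemidef) (htr1 : ρ.trace = 1) (hpure : ρ * ρ = ρ) :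
    sAB lam ρ + sAC lam ρ + sAD lam ρ =
      ((d : ℝ) ^ 2 - 1 + ((d : ℝ) ^ 2 - 3) * aSq lam ρ - RBCDsq lam ρ) /
        ((d : ℝ) ^ 2 - 1) := by
  have hρ := hpsd.isHermitian
  have hL : lamKernel lam = (d : ℂ) • swapKernel - idKernel := by
    ext x y z w
    exact lamKernel_eq lam hd htr0 horth x y z w
  have hA := pairing_kernel4_swap ρ hpure htr1 idKernel swapKernel swapKernel swapKernel
  have hAB := pairing_kernel4_swap ρ hpure htr1 idKernel idKernel swapKernel swapKernel
  have hAC := pairing_kernel4_swap ρ hpure htr1 idKernel swapKernel idKernel swapKernel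
  have hAD := pairing_kernel4_swap ρ hpure htr1 idKernel swapKernel swapKernel idKernel
  have hone := pairing_idKernel ρ htr1
  have hkernel :
      kernel4 (lamKernel lam) (lamKernel lam) idKernel idKernel +
      kernel4 (lamKernel lam) idKernel (lamKernel lam) idKernel +
      kernel4 (lamKernel lam) idKernel idKernel (lamKernel lam) +
      kernel4 idKernel (lamKernel lam) (lamKernel lam) (lamKernel lam) =
      ((d : ℂ) ^ 2 - 1) • kernel4 idKernel idKernel idKernel idKernel +
      ((d : ℂ) ^ 2 - 3) • kernel4 (lamKernel lam) idKernel idKernel idKernel +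
      (d : ℂ) ^ 2 • (kernel4 swapKernel swapKernel idKernel idKernel -
        kernel4 idKernel idKernel swapKernel swapKernel) +
      (d : ℂ) ^ 2 • (kernel4 swapKernel idKernel swapKernel idKernel -
        kernel4 idKernel swapKernel idKernel swapKernel) +
      (d : ℂ) ^ 2 • (kernel4 swapKernel idKernel idKernel swapKernel -
        kernel4 idKernel swapKernel swapKernel idKernel) +
      (d : ℂ) ^ 3 • (kernel4 idKernel swapKernel swapKernel swapKernel -
        kernel4 swapKernel idKernel idKernel idKernel) := by
    ext p q r s
    simp only [hL, kernel4, Pi.add_apply, Pi.sub_apply, Pi.smul_apply, smul_eq_mul]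
    ring
  have hpair := congrArg (pairing ρ) hkernel
  simp only [map_add, map_sub, map_smul, smul_eq_mul] at hpair
  have hmain : RABsq lam ρ + RACsq lam ρ + RADsq lam ρ =
      (d : ℝ) ^ 2 - 1 + ((d : ℝ) ^ 2 - 3) * aSq lam ρ - RBCDsq lam ρ := by
    apply Complex.ofReal_injective
    push_cast
    rw [RABsq_eq_pairing lam ρ hherm hρ, RACsq_eq_pairing lam ρ hherm hρ,
      RADsq_eq_pairing lam ρ hherm hρ, RBCDsq_eq_pairing lam ρ hherm hρ,
      aSq_eq_pairing lam ρ hherm hρ]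
    change pairing ρ (kernel4 swapKernel idKernel idKernel idKernel) = _ at hA
    change pairing ρ (kernel4 swapKernel swapKernel idKernel idKernel) = _ at hAB
    change pairing ρ (kernel4 swapKernel idKernel swapKernel idKernel) = _ at hAC
    change pairing ρ (kernel4 swapKernel idKernel idKernel swapKernel) = _ at hAD
    rw [hA, hAB, hAC, hAD, hone] at hpair
    linear_combination hpair
  rw [sAB, sAC, sAD, ← add_div, ← add_div, hmain]

end SpinCorr4
end

section
/- Let ρ be a pure four-qubit state on ℂ² ⊗ ℂ² ⊗ ℂ² ⊗ ℂ². Then the six isotropic strengths satisfy s_iso^{AB} + s_iso^{AC} + s_iso^{AD} + s_iso^{BC} + s_iso^{CD} + s_iso^{BD} = (12 + ‖a‖² − ‖R^{BCD}‖² + ‖b‖² − ‖R^{ACD}‖² + ‖c‖² − ‖R^{ABD}‖² + ‖d‖² − ‖R^{ABC}‖²)/6, and this sum is at most 2. -/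
open Matrix ComplexOrder

namespace SpinCorrQubit

/-- Tensor (Kronecker) product of four `2 × 2` matrices, acting on `(ℂ²)^{⊗4}`. -/
noncomputable def kron4 (A B C D : Matrix (Fin 2) (Fin 2) ℂ) :
    Matrix (Fin 2 × Fin 2 × Fin 2 × Fin 2) (Fin 2 × Fin 2 × Fin 2 × Fin 2) ℂ :=
  Matrix.of fun p q =>
    A p.1 q.1 * B p.2.1 q.2.1 * C p.2.2.1 q.2.2.1 * D p.2.2.2 q.2.2.2

variable (σ : Fin 3 → Matrix (Fin 2) (Fin 2) ℂ)
variable (ρ : Matrix (Fin 2 × Fin 2 × Fin 2 × Fin 2) (Fin 2 × Fin 2 × Fin 2 × Fin 2) ℂ)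

/-- `‖a‖²`, the squared Euclidean norm of the Bloch vector of party A. -/
noncomputable def aSq : ℝ := ∑ i, ‖(ρ * kron4 (σ i) 1 1 1).trace‖ ^ 2

/-- `‖b‖²`. -/
noncomputable def bSq : ℝ := ∑ i, ‖(ρ * kron4 1 (σ i) 1 1).trace‖ ^ 2

/-- `‖c‖²`. -/
noncomputable def cSq : ℝ := ∑ i, ‖(ρ * kron4 1 1 (σ i) 1).trace‖ ^ 2

/-- `‖d‖²`. -/
noncomputable def dSq : ℝ := ∑ i, ‖(ρ * kron4 1 1 1 (σ i)).trace‖ ^ 2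

/-- `‖R^{AB}‖²`, squared Frobenius norm of the spin correlation matrix of parties A,B. -/
noncomputable def RABsq : ℝ := ∑ i, ∑ j, ‖(ρ * kron4 (σ i) (σ j) 1 1).trace‖ ^ 2

/-- `‖R^{AC}‖²`. -/
noncomputable def RACsq : ℝ := ∑ i, ∑ j, ‖(ρ * kron4 (σ i) 1 (σ j) 1).trace‖ ^ 2

/-- `‖R^{AD}‖²`. -/
noncomputable def RADsq : ℝ := ∑ i, ∑ j, ‖(ρ * kron4 (σ i) 1 1 (σ j)).trace‖ ^ 2

/-- `‖R^{BC}‖²`. -/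
noncomputable def RBCsq : ℝ := ∑ i, ∑ j, ‖(ρ * kron4 1 (σ i) (σ j) 1).trace‖ ^ 2

/-- `‖R^{BD}‖²`. -/
noncomputable def RBDsq : ℝ := ∑ i, ∑ j, ‖(ρ * kron4 1 (σ i) 1 (σ j)).trace‖ ^ 2

/-- `‖R^{CD}‖²`. -/
noncomputable def RCDsq : ℝ := ∑ i, ∑ j, ‖(ρ * kron4 1 1 (σ i) (σ j)).trace‖ ^ 2

/-- `‖R^{ABC}‖²`, squared Euclidean norm of the three-body correlation tensor of A,B,C. -/
noncomputable def RABCsq : ℝ :=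
  ∑ i, ∑ j, ∑ l, ‖(ρ * kron4 (σ i) (σ j) (σ l) 1).trace‖ ^ 2

/-- `‖R^{ABD}‖²`. -/
noncomputable def RABDsq : ℝ :=
  ∑ i, ∑ j, ∑ l, ‖(ρ * kron4 (σ i) (σ j) 1 (σ l)).trace‖ ^ 2

/-- `‖R^{ACD}‖²`. -/
noncomputable def RACDsq : ℝ :=
  ∑ i, ∑ j, ∑ l, ‖(ρ * kron4 (σ i) 1 (σ j) (σ l)).trace‖ ^ 2

/-- `‖R^{BCD}‖²`. -/
noncomputable def RBCDsq : ℝ :=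
  ∑ i, ∑ j, ∑ l, ‖(ρ * kron4 1 (σ i) (σ j) (σ l)).trace‖ ^ 2

/-- Isotropic strength `s_iso^{AB} = ‖R^{AB}‖²/3`. -/
noncomputable def sAB : ℝ := RABsq σ ρ / 3

/-- `s_iso^{AC}`. -/
noncomputable def sAC : ℝ := RACsq σ ρ / 3

/-- `s_iso^{AD}`. -/
noncomputable def sAD : ℝ := RADsq σ ρ / 3

/-- `s_iso^{BC}`. -/
noncomputable def sBC : ℝ := RBCsq σ ρ / 3

/-- `s_iso^{BD}`. -/
noncomputable def sBD : ℝ := RBDsq σ ρ / 3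

/-- `s_iso^{CD}`. -/
noncomputable def sCD : ℝ := RCDsq σ ρ / 3

/-- The signs of the entries of the spin flip `iσ_y`. -/
def flipSign : Fin 2 → ℂ := ![1, -1]

/-- Amplitudes of a four-qubit state vector. -/
abbrev Amplitudes := Fin 2 → Fin 2 → Fin 2 → Fin 2 → ℂ

/-- Contraction of the first two parties of `ψ ⊗ ψ` with the spin-flip form. -/
def flipContract (ψ : Amplitudes) (c d c' d' : Fin 2) : ℂ :=
  ∑ a, ∑ b, flipSign a * flipSign b * ψ a b c d * ψ (1 - a) (1 - b) c' d'

/-- Overlap of `ψ` with its spin-flipped conjugate. -/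
def flipForm (ψ : Amplitudes) : ℂ :=
  ∑ c, ∑ d, flipSign c * flipSign d * flipContract ψ c d (1 - c) (1 - d)

/-- The quartic invariant obtained by contracting `flipContract ψ` with itself. -/
def flipQuartic (ψ : Amplitudes) : ℂ :=
  ∑ c, ∑ d, ∑ c', ∑ d', flipSign c * flipSign d * flipSign c' * flipSign d' *
    flipContract ψ c d c' d' * flipContract ψ (1 - c) (1 - d) (1 - c') (1 - d')

/-- Purity of the reduced state of the first party, for a normalized state. -/
noncomputable def purity₁ (ψ : Amplitudes) : ℝ :=
  ∑ a, ∑ a', ‖∑ b, ∑ c, ∑ d, ψ a b c d * star (ψ a' b c d)‖ ^ 2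

/-- Purity of the reduced state of the first two parties, for a normalized state. -/
noncomputable def purity₂ (ψ : Amplitudes) : ℝ :=
  ∑ a, ∑ a', ∑ b, ∑ b', ‖∑ c, ∑ d, ψ a b c d * star (ψ a' b' c d)‖ ^ 2

/-- Purity of the reduced state of the first three parties, for a normalized state. -/
noncomputable def purity₃ (ψ : Amplitudes) : ℝ :=
  ∑ a, ∑ a', ∑ b, ∑ b', ∑ c, ∑ c', ‖∑ d, ψ a b c d * star (ψ a' b' c' d)‖ ^ 2

/-- Squared norm of a state vector. -/
noncomputable def sqNorm (ψ : Amplitudes) : ℝ := ∑ a, ∑ b, ∑ c, ∑ d, ‖ψ a b c d‖ ^ 2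

/-- The six quartic invariants sum to three times the square of the quadratic one. -/
theorem sum_flipQuartic (ψ : Amplitudes) :
    flipQuartic ψ + flipQuartic (fun a c b d => ψ a b c d) +
      flipQuartic (fun a d b c => ψ a b c d) + flipQuartic (fun b c a d => ψ a b c d) +
      flipQuartic (fun b d a c => ψ a b c d) + flipQuartic (fun c d a b => ψ a b c d) =
    3 * flipForm ψ ^ 2 := by
  simp only [flipQuartic, flipForm, flipContract, flipSign, Fin.sum_univ_two, Fin.isValue,
    sub_zero, sub_self, cons_val_zero, cons_val_one]
  ring

/-- The squared norm of `flipContract ψ` in terms of purities. -/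
theorem sum_sq_flipContract (ψ : Amplitudes) :
    ∑ c, ∑ d, ∑ c', ∑ d', ‖flipContract ψ c d c' d'‖ ^ 2 =
      sqNorm ψ ^ 2 - purity₁ ψ - purity₁ (fun b a c d => ψ a b c d) + purity₂ ψ := by
  apply Complex.ofReal_injective
  simp only [sqNorm, purity₁, purity₂, flipContract, flipSign, Fin.sum_univ_two, Fin.isValue,
    sub_zero, sub_self, cons_val_zero, cons_val_one, Complex.ofReal_add, Complex.ofReal_sub,
    Complex.ofReal_pow, ← Complex.mul_conj', map_add, map_mul, map_neg, map_one,
    Complex.star_def, Complex.conj_conj]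
  ring

/-- The squared modulus of the spin-flip form in terms of purities. -/
theorem sq_norm_flipForm (ψ : Amplitudes) :
    ‖flipForm ψ‖ ^ 2 = 2 * (sqNorm ψ ^ 2 - purity₁ ψ - purity₁ (fun b a c d => ψ a b c d) -
      purity₁ (fun c a b d => ψ a b c d) - purity₁ (fun d a b c => ψ a b c d) +
      purity₂ ψ + purity₂ (fun a c b d => ψ a b c d) + purity₂ (fun a d b c => ψ a b c d)) := by
  apply Complex.ofReal_injective
  simp only [sqNorm, purity₁, purity₂, flipForm, flipContract, flipSign, Fin.sum_univ_two,
    Fin.isValue, sub_zero, sub_self, cons_val_zero, cons_val_one, Complex.ofReal_add,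
    Complex.ofReal_sub, Complex.ofReal_mul, Complex.ofReal_ofNat,
    Complex.ofReal_pow, ← Complex.mul_conj', map_add, map_mul, map_neg, map_one,
    Complex.star_def, Complex.conj_conj]
  ring

/-- Cauchy–Schwarz bound for the quartic invariant. -/
theorem norm_flipQuartic_le (ψ : Amplitudes) :
    ‖flipQuartic ψ‖ ≤
      sqNorm ψ ^ 2 - purity₁ ψ - purity₁ (fun b a c d => ψ a b c d) + purity₂ ψ := by
  rw [← sum_sq_flipContract]
  have hsign : ∀ a, ‖flipSign a‖ = 1 := by intro a; fin_cases a <;> simp [flipSign]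
  have hterm (c d c' d' : Fin 2) : ‖flipSign c * flipSign d * flipSign c' * flipSign d' *
      flipContract ψ c d c' d' * flipContract ψ (1 - c) (1 - d) (1 - c') (1 - d')‖ ≤
      (‖flipContract ψ c d c' d'‖ ^ 2 +
        ‖flipContract ψ (1 - c) (1 - d) (1 - c') (1 - d')‖ ^ 2) / 2 := by
    simp only [norm_mul, hsign, one_mul]
    linarith [two_mul_le_add_sq ‖flipContract ψ c d c' d'‖
      ‖flipContract ψ (1 - c) (1 - d) (1 - c') (1 - d')‖]
  refine (norm_sum_le_of_le _ fun c _ => norm_sum_le_of_le _ fun d _ =>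
    norm_sum_le_of_le _ fun c' _ => norm_sum_le_of_le _ fun d' _ => hterm c d c' d').trans_eq ?_
  simp only [Fin.sum_univ_two, Fin.isValue, sub_zero, sub_self]
  ring

/-- A complex matrix and its conjugate transpose have Gram arrays of the same Frobenius norm. -/
theorem sum_sq_norm_gram_comm {m n : Type*} [Fintype m] [Fintype n] (M : Matrix m n ℂ) :
    ∑ i, ∑ j, ‖∑ k, M i k * star (M j k)‖ ^ 2 = ∑ k, ∑ l, ‖∑ i, M i k * star (M i l)‖ ^ 2 := by
  apply Complex.ofReal_injective
  have h : (M * Mᴴ * (M * Mᴴ)).trace = (Mᴴ * M * (Mᴴ * M)).trace := by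
    simpa only [Matrix.mul_assoc] using trace_mul_comm (M * Mᴴ * M) Mᴴ
  push_cast
  simp only [← Complex.mul_conj', map_sum, map_mul, Complex.star_def, Complex.conj_conj]
  convert h using 1
  · simp only [trace, diag_apply, mul_apply, conjTranspose_apply, Complex.star_def]
    refine Finset.sum_congr rfl fun i _ => Finset.sum_congr rfl fun j _ => ?_
    congr 1
    exact Finset.sum_congr rfl fun _ _ => mul_comm _ _
  · simp only [trace, diag_apply, mul_apply, conjTranspose_apply, Complex.star_def]
    refine Finset.sum_congr rfl fun i _ => Finset.sum_congr rfl fun j _ => ?_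
    rw [mul_comm]
    congr 1
    exact Finset.sum_congr rfl fun _ _ => mul_comm _ _

/-- Three parties have the same purity as the remaining party. -/
theorem purity₃_compl (ψ : Amplitudes) :
    purity₃ (fun b c d a => ψ a b c d) = purity₁ ψ := by
  have h := sum_sq_norm_gram_comm
    (Matrix.of fun (a : Fin 2) (p : Fin 2 × Fin 2 × Fin 2) => ψ a p.1 p.2.1 p.2.2)
  simp only [Fintype.sum_prod_type, of_apply] at h
  rw [purity₁, h, purity₃]
  simp only [Fin.sum_univ_two]
  ring

/-- Two parties have the same purity as the other two. -/
theorem purity₂_compl (ψ : Amplitudes) :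
    purity₂ (fun c d a b => ψ a b c d) = purity₂ ψ := by
  have h := sum_sq_norm_gram_comm
    (Matrix.of fun (p q : Fin 2 × Fin 2) => ψ p.1 p.2 q.1 q.2)
  simp only [Fintype.sum_prod_type, of_apply] at h
  rw [purity₂, purity₂]
  simp only [Fin.sum_univ_two] at h ⊢
  linear_combination -h

theorem sqNorm_swap₁₂ (ψ : Amplitudes) : sqNorm (fun b a c d => ψ a b c d) = sqNorm ψ :=
  Finset.sum_comm

theorem sqNorm_swap₂₃ (ψ : Amplitudes) : sqNorm (fun a c b d => ψ a b c d) = sqNorm ψ :=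
  Finset.sum_congr rfl fun _ _ => Finset.sum_comm

theorem sqNorm_swap₃₄ (ψ : Amplitudes) : sqNorm (fun a b d c => ψ a b c d) = sqNorm ψ :=
  Finset.sum_congr rfl fun _ _ => Finset.sum_congr rfl fun _ _ => Finset.sum_comm

theorem purity₁_swap₂₃ (ψ : Amplitudes) :
    purity₁ (fun a c b d => ψ a b c d) = purity₁ ψ := by
  unfold purity₁
  refine Finset.sum_congr rfl fun a _ => Finset.sum_congr rfl fun a' _ => ?_
  rw [Finset.sum_comm]

theorem purity₁_swap₃₄ (ψ : Amplitudes) :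
    purity₁ (fun a b d c => ψ a b c d) = purity₁ ψ := by
  unfold purity₁
  refine Finset.sum_congr rfl fun a _ => Finset.sum_congr rfl fun a' _ => ?_
  congr 2
  exact Finset.sum_congr rfl fun b _ => Finset.sum_comm

theorem purity₁_rotate (ψ : Amplitudes) :
    purity₁ (fun a d b c => ψ a b c d) = purity₁ ψ :=
  (purity₁_swap₂₃ _).trans (purity₁_swap₃₄ _)

theorem purity₁_rotate' (ψ : Amplitudes) :
    purity₁ (fun a c d b => ψ a b c d) = purity₁ ψ :=
  (purity₁_swap₃₄ _).trans (purity₁_swap₂₃ _)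

theorem purity₂_swap₃₄ (ψ : Amplitudes) :
    purity₂ (fun a b d c => ψ a b c d) = purity₂ ψ := by
  unfold purity₂
  refine Finset.sum_congr rfl fun a _ => Finset.sum_congr rfl fun a' _ =>
    Finset.sum_congr rfl fun b _ => Finset.sum_congr rfl fun b' _ => ?_
  rw [Finset.sum_comm]

/-- The two-party purities are bounded by the one-party ones. -/
theorem purity₂_sum_le (ψ : Amplitudes) :
    4 * (purity₂ ψ + purity₂ (fun a c b d => ψ a b c d) + purity₂ (fun a d b c => ψ a b c d)) ≤
      3 * (purity₁ ψ + purity₁ (fun b a c d => ψ a b c d) + purity₁ (fun c a b d => ψ a b c d) +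
        purity₁ (fun d a b c => ψ a b c d)) := by
  have h := congrArg norm (sum_flipQuartic ψ)
  rw [norm_mul, norm_pow, sq_norm_flipForm, Complex.norm_ofNat] at h
  have h₁ := norm_flipQuartic_le ψ
  have h₂ := norm_flipQuartic_le (fun a c b d => ψ a b c d)
  have h₃ := norm_flipQuartic_le (fun a d b c => ψ a b c d)
  have h₄ := norm_flipQuartic_le (fun b c a d => ψ a b c d)
  have h₅ := norm_flipQuartic_le (fun b d a c => ψ a b c d)
  have h₆ := norm_flipQuartic_le (fun c d a b => ψ a b c d)
  have hle := h.ge.trans <| norm_add_le_of_le (norm_add_le_of_le (norm_add_le_of_le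
    (norm_add_le_of_le (norm_add_le_of_le h₁ h₂) h₃) h₄) h₅) h₆
  have s₂ := sqNorm_swap₂₃ ψ
  have s₃ : sqNorm (fun a d b c => ψ a b c d) = sqNorm ψ :=
    (sqNorm_swap₂₃ _).trans (sqNorm_swap₃₄ _)
  have s₄ : sqNorm (fun b c a d => ψ a b c d) = sqNorm ψ :=
    (sqNorm_swap₂₃ _).trans (sqNorm_swap₁₂ _)
  have s₅ : sqNorm (fun b d a c => ψ a b c d) = sqNorm ψ :=
    (sqNorm_swap₂₃ _).trans ((sqNorm_swap₁₂ _).trans (sqNorm_swap₃₄ _))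
  have s₆ : sqNorm (fun c d a b => ψ a b c d) = sqNorm ψ :=
    (sqNorm_swap₂₃ _).trans ((sqNorm_swap₁₂ _).trans ((sqNorm_swap₃₄ _).trans (sqNorm_swap₂₃ _)))
  rw [s₂, s₃, s₄, s₅, s₆] at hle
  linarith only [hle, purity₁_swap₂₃ ψ, purity₁_rotate ψ,
    purity₁_swap₂₃ (fun b a c d => ψ a b c d), purity₁_rotate (fun b a c d => ψ a b c d),
    purity₁_swap₂₃ (fun c a b d => ψ a b c d), purity₁_rotate (fun c a b d => ψ a b c d),
    purity₁_swap₂₃ (fun d a b c => ψ a b c d), purity₁_rotate (fun d a b c => ψ a b c d),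
    purity₂_compl ψ, purity₂_compl (fun a c b d => ψ a b c d),
    purity₂_compl (fun a d b c => ψ a b c d)]

/-- A Hermitian idempotent of trace one is the projection onto the span of a unit vector. -/
theorem exists_eq_vecMulVec_star {n : Type*} [Fintype n] {ρ : Matrix n n ℂ}
    (hherm : ρ.IsHermitian) (htr : ρ.trace = 1) (hidem : ρ * ρ = ρ) :
    ∃ v : n → ℂ, ρ = vecMulVec v (star v) := by
  obtain ⟨j, hj⟩ : ∃ j, ρ j j ≠ 0 := by
    by_contra! h
    simp [trace, h] at htr
  set u := ρ.col j with hu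
  have hcol : star u ⬝ᵥ u = ρ j j := by
    conv_rhs => rw [← hidem]
    simp only [hu, dotProduct, mul_apply, Pi.star_apply, col_apply, hherm.apply]
  have hpos : 0 < ρ j j := lt_of_le_of_ne (hcol ▸ dotProduct_star_self_nonneg _) hj.symm
  obtain ⟨r, hr, hrj⟩ : ∃ r : ℝ, 0 < r ∧ (r : ℂ) = ρ j j :=
    ⟨(ρ j j).re, (Complex.pos_iff.1 hpos).1, Complex.ext rfl (Complex.pos_iff.1 hpos).2⟩
  have hρu : ρ *ᵥ u = u := by
    ext i
    conv_rhs => rw [hu, ← hidem]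
    simp [hu, mulVec, dotProduct, mul_apply]
  have huρ : star u ᵥ* ρ = star u := by
    have := congrArg star hρu
    rwa [star_mulVec, hherm.eq] at this
  have hPP : vecMulVec u (star u) * vecMulVec u (star u) = ρ j j • vecMulVec u (star u) := by
    rw [vecMulVec_mul_vecMulVec, hcol, vecMulVec_smul]
  have hQ : ρ - (ρ j j)⁻¹ • vecMulVec u (star u) = 0 := by
    rw [← trace_conjTranspose_mul_self_eq_zero_iff]
    have hstar : star (ρ j j) = ρ j j := hherm.apply j j
    rw [conjTranspose_sub, conjTranspose_smul, conjTranspose_vecMulVec, star_star, hherm.eq,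
      star_inv₀, hstar, sub_mul, mul_sub, mul_sub, hidem, Matrix.mul_smul, Matrix.smul_mul,
      Matrix.mul_smul, Matrix.smul_mul,
      hPP, mul_vecMulVec, vecMulVec_mul, hρu, huρ]
    simp [trace_vecMulVec, htr, dotProduct_comm u, hcol, hj]
  refine ⟨((√r)⁻¹ : ℂ) • u, ?_⟩
  rw [sub_eq_zero.1 hQ, star_smul, smul_vecMulVec, vecMulVec_smul, smul_smul]
  congr 1
  rw [← hrj, Complex.star_def, map_inv₀, Complex.conj_ofReal, ← mul_inv, ← Complex.ofReal_mul,
    Real.mul_self_sqrt hr.le]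

section Pauli

variable {σ : Fin 3 → Matrix (Fin 2) (Fin 2) ℂ}

/-- Completeness relation for an orthogonal basis of traceless Hermitian `2 × 2` matrices. -/
theorem pauli_completeness (hherm : ∀ i, (σ i).IsHermitian) (htr0 : ∀ i, (σ i).trace = 0)
    (horth : ∀ i j, (σ i * σ j).trace = if i = j then (2 : ℂ) else 0) (a b c d : Fin 2) :
    ∑ i, σ i a b * star (σ i c d) =
      2 * ((1 : Matrix (Fin 2) (Fin 2) ℂ) a c * (1 : Matrix (Fin 2) (Fin 2) ℂ) b d) -
        (1 : Matrix (Fin 2) (Fin 2) ℂ) a b * (1 : Matrix (Fin 2) (Fin 2) ℂ) c d := by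
  let τ : Option (Fin 3) → Matrix (Fin 2) (Fin 2) ℂ := fun μ => μ.elim 1 σ
  have hτ (μ) : (τ μ).IsHermitian := by
    cases μ with
    | none => exact isHermitian_one
    | some i => exact hherm i
  have hτorth (μ ν) : (τ μ * τ ν).trace = if μ = ν then (2 : ℂ) else 0 := by
    cases μ <;> cases ν <;> simp [τ, htr0, horth]
  let U : Matrix (Option (Fin 3)) (Fin 2 × Fin 2) ℂ := Matrix.of fun μ p => τ μ p.1 p.2
  have hU : U * ((2⁻¹ : ℂ) • Uᴴ) = 1 := by
    ext μ ν
    have : (U * Uᴴ) μ ν = (τ μ * τ ν).trace := by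
      simp only [U, mul_apply, conjTranspose_apply, of_apply, Fintype.sum_prod_type, trace,
        diag_apply, (hτ ν).apply]
    rw [Matrix.mul_smul, Matrix.smul_apply, this, hτorth, one_apply]
    split_ifs <;> simp
  have hV : ((2⁻¹ : ℂ) • Uᴴ) * U = 1 := (mul_eq_one_comm_of_card_eq _ _ _ (by simp)).1 hU
  have h := congrFun (congrFun hV (c, d)) (a, b)
  simp only [Matrix.smul_apply, mul_apply, conjTranspose_apply, U, τ, of_apply,
    Fintype.sum_option, Option.elim, one_apply, Prod.mk.injEq, smul_eq_mul] at h ⊢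
  have hsum : ∑ i, σ i a b * star (σ i c d) = 2 * ∑ i, 2⁻¹ * star (σ i c d) * σ i a b := by
    rw [Finset.mul_sum]
    exact Finset.sum_congr rfl fun i _ => by ring
  rw [hsum, eq_sub_of_add_eq' h, apply_ite star, star_one, star_zero, mul_sub]
  congr 1
  · simp only [← ite_and, mul_ite, mul_one, mul_zero, eq_comm (a := c), eq_comm (a := d)]
    simp only [and_comm]
  · ring

/-- The sum rule for one linear functional evaluated at the Pauli matrices. -/
theorem sum_sq_norm_pauli (hherm : ∀ i, (σ i).IsHermitian) (htr0 : ∀ i, (σ i).trace = 0)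
    (horth : ∀ i j, (σ i * σ j).trace = if i = j then (2 : ℂ) else 0) (g : Fin 2 → Fin 2 → ℂ) :
    ∑ i, ‖∑ a, ∑ b, σ i a b * g a b‖ ^ 2 =
      2 * ∑ a, ∑ b, ‖g a b‖ ^ 2 - ‖∑ a, g a a‖ ^ 2 := by
  apply Complex.ofReal_injective
  have h := pauli_completeness hherm htr0 horth
  push_cast
  simp only [← Complex.mul_conj', ← Complex.star_def, star_sum, star_mul']
  have hswap : ∑ i, (∑ a, ∑ b, σ i a b * g a b) * (∑ c, ∑ d, star (σ i c d) * star (g c d)) =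
      ∑ a, ∑ b, ∑ c, ∑ d, (∑ i, σ i a b * star (σ i c d)) * (g a b * star (g c d)) := by
    simp only [Fin.sum_univ_two, Fin.sum_univ_three]
    ring
  rw [hswap]
  simp only [h, Fin.sum_univ_two, one_apply]
  simp
  ring

end Pauli

/-- Expectation value of `X ⊗ Y ⊗ Z ⊗ W` in the state vector `ψ`. -/
noncomputable def expectation (ψ : Amplitudes) (X Y Z W : Matrix (Fin 2) (Fin 2) ℂ) : ℂ :=
  ∑ p : Fin 2 × Fin 2, ∑ q : Fin 2 × Fin 2, ∑ r : Fin 2 × Fin 2, ∑ s : Fin 2 × Fin 2,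
    X p.1 p.2 * Y q.1 q.2 * Z r.1 r.2 * W s.1 s.2 *
      (ψ p.2 q.2 r.2 s.2 * star (ψ p.1 q.1 r.1 s.1))

theorem trace_vecMulVec_mul_kron4 (v : Fin 2 × Fin 2 × Fin 2 × Fin 2 → ℂ)
    (X Y Z W : Matrix (Fin 2) (Fin 2) ℂ) :
    (vecMulVec v (star v) * kron4 X Y Z W).trace =
      expectation (fun a b c d => v (a, b, c, d)) X Y Z W := by
  simp only [trace, diag_apply, mul_apply, vecMulVec_apply, kron4, of_apply, expectation,
    Fintype.sum_prod_type, Pi.star_apply, Fin.sum_univ_two]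
  ring

theorem expectation_swap₁₂ (ψ : Amplitudes) (X Y Z W : Matrix (Fin 2) (Fin 2) ℂ) :
    expectation (fun b a c d => ψ a b c d) Y X Z W = expectation ψ X Y Z W := by
  rw [expectation, Finset.sum_comm]
  simp only [expectation, mul_comm (Y _ _)]

theorem expectation_swap₂₃ (ψ : Amplitudes) (X Y Z W : Matrix (Fin 2) (Fin 2) ℂ) :
    expectation (fun a c b d => ψ a b c d) X Z Y W = expectation ψ X Y Z W := by
  refine Finset.sum_congr rfl fun p _ => ?_
  rw [Finset.sum_comm]
  simp only [mul_right_comm _ (Z _ _)]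

theorem expectation_swap₃₄ (ψ : Amplitudes) (X Y Z W : Matrix (Fin 2) (Fin 2) ℂ) :
    expectation (fun a b d c => ψ a b c d) X Y W Z = expectation ψ X Y Z W := by
  refine Finset.sum_congr rfl fun p _ => Finset.sum_congr rfl fun q _ => ?_
  rw [Finset.sum_comm]
  simp only [mul_right_comm _ (W _ _)]

theorem expectation_single (ψ : Amplitudes) (a a' : Fin 2) (Y Z W : Matrix (Fin 2) (Fin 2) ℂ) :
    expectation ψ (single a a' 1) Y Z W =
      ∑ q : Fin 2 × Fin 2, ∑ r : Fin 2 × Fin 2, ∑ s : Fin 2 × Fin 2,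
        Y q.1 q.2 * Z r.1 r.2 * W s.1 s.2 * (ψ a' q.2 r.2 s.2 * star (ψ a q.1 r.1 s.1)) := by
  rw [expectation, Finset.sum_eq_single (a, a')]
  · simp
  · rintro ⟨b, b'⟩ - hb
    have : single a a' (1 : ℂ) b b' = 0 := by
      apply single_apply_of_ne
      rintro ⟨rfl, rfl⟩
      exact hb rfl
    simp [this]
  · simp

theorem expectation_eq_sum_single (ψ : Amplitudes) (X Y Z W : Matrix (Fin 2) (Fin 2) ℂ) :
    expectation ψ X Y Z W = ∑ a, ∑ a', X a a' * expectation ψ (single a a' 1) Y Z W := by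
  simp only [expectation_single]
  rw [expectation, Fintype.sum_prod_type]
  simp only [Finset.mul_sum, mul_assoc]

theorem purity₁_eq_sum_expectation (ψ : Amplitudes) :
    purity₁ ψ = ∑ a, ∑ a', ‖expectation ψ (single a a' 1) 1 1 1‖ ^ 2 := by
  rw [purity₁, Finset.sum_comm]
  simp [expectation_single, Fintype.sum_prod_type, one_apply]

theorem purity₂_eq_sum_expectation (ψ : Amplitudes) :
    purity₂ ψ =
      ∑ a, ∑ a', ∑ b, ∑ b', ‖expectation ψ (single a a' 1) (single b b' 1) 1 1‖ ^ 2 := by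
  rw [purity₂, Finset.sum_comm]
  refine Finset.sum_congr rfl fun a _ => Finset.sum_congr rfl fun a' _ => ?_
  rw [Finset.sum_comm]
  simp [expectation_single, Fintype.sum_prod_type, one_apply, single_apply, ite_and]

theorem purity₃_eq_sum_expectation (ψ : Amplitudes) :
    purity₃ ψ = ∑ a, ∑ a', ∑ b, ∑ b', ∑ c, ∑ c',
      ‖expectation ψ (single a a' 1) (single b b' 1) (single c c' 1) 1‖ ^ 2 := by
  rw [purity₃, Finset.sum_comm]
  refine Finset.sum_congr rfl fun a _ => Finset.sum_congr rfl fun a' _ => ?_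
  rw [Finset.sum_comm]
  refine Finset.sum_congr rfl fun b _ => Finset.sum_congr rfl fun b' _ => ?_
  rw [Finset.sum_comm]
  simp [expectation_single, Fintype.sum_prod_type, one_apply, single_apply, ite_and]

section Pauli

variable {σ : Fin 3 → Matrix (Fin 2) (Fin 2) ℂ}

/-- The sum of squared expectation values over the Pauli matrices of the first party. -/
theorem sum_sq_norm_expectation_pauli₁ (hherm : ∀ i, (σ i).IsHermitian)
    (htr0 : ∀ i, (σ i).trace = 0)
    (horth : ∀ i j, (σ i * σ j).trace = if i = j then (2 : ℂ) else 0)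
    (ψ : Amplitudes) (Y Z W : Matrix (Fin 2) (Fin 2) ℂ) :
    ∑ i, ‖expectation ψ (σ i) Y Z W‖ ^ 2 =
      2 * ∑ a, ∑ a', ‖expectation ψ (single a a' 1) Y Z W‖ ^ 2 - ‖expectation ψ 1 Y Z W‖ ^ 2 := by
  have h := sum_sq_norm_pauli hherm htr0 horth fun a a' => expectation ψ (single a a' 1) Y Z W
  simp only [← expectation_eq_sum_single] at h
  rw [h, expectation_eq_sum_single ψ 1]
  simp [one_apply]

theorem sum_sq_norm_expectation_pauli₂ (hherm : ∀ i, (σ i).IsHermitian)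
    (htr0 : ∀ i, (σ i).trace = 0)
    (horth : ∀ i j, (σ i * σ j).trace = if i = j then (2 : ℂ) else 0)
    (ψ : Amplitudes) (X Z W : Matrix (Fin 2) (Fin 2) ℂ) :
    ∑ i, ‖expectation ψ X (σ i) Z W‖ ^ 2 =
      2 * ∑ b, ∑ b', ‖expectation ψ X (single b b' 1) Z W‖ ^ 2 - ‖expectation ψ X 1 Z W‖ ^ 2 := by
  simp only [← expectation_swap₁₂ ψ X]
  exact sum_sq_norm_expectation_pauli₁ hherm htr0 horth _ X Z W

theorem sum_sq_norm_expectation_pauli₃ (hherm : ∀ i, (σ i).IsHermitian)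
    (htr0 : ∀ i, (σ i).trace = 0)
    (horth : ∀ i j, (σ i * σ j).trace = if i = j then (2 : ℂ) else 0)
    (ψ : Amplitudes) (X Y W : Matrix (Fin 2) (Fin 2) ℂ) :
    ∑ i, ‖expectation ψ X Y (σ i) W‖ ^ 2 =
      2 * ∑ c, ∑ c', ‖expectation ψ X Y (single c c' 1) W‖ ^ 2 - ‖expectation ψ X Y 1 W‖ ^ 2 := by
  simp only [← expectation_swap₂₃ ψ X Y]
  exact sum_sq_norm_expectation_pauli₂ hherm htr0 horth _ X Y W

/-- The squared norm of a Bloch vector in terms of purities. -/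
theorem oneBody_eq (hherm : ∀ i, (σ i).IsHermitian)
    (htr0 : ∀ i, (σ i).trace = 0)
    (horth : ∀ i j, (σ i * σ j).trace = if i = j then (2 : ℂ) else 0)
    (ψ : Amplitudes) :
    ∑ i, ‖expectation ψ (σ i) 1 1 1‖ ^ 2 = 2 * purity₁ ψ - ‖expectation ψ 1 1 1 1‖ ^ 2 := by
  rw [sum_sq_norm_expectation_pauli₁ hherm htr0 horth, ← purity₁_eq_sum_expectation]

/-- The squared norm of a spin correlation matrix in terms of purities. -/
theorem twoBody_eq (hherm : ∀ i, (σ i).IsHermitian)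
    (htr0 : ∀ i, (σ i).trace = 0)
    (horth : ∀ i j, (σ i * σ j).trace = if i = j then (2 : ℂ) else 0)
    (ψ : Amplitudes) :
    ∑ i, ∑ j, ‖expectation ψ (σ i) (σ j) 1 1‖ ^ 2 =
      4 * purity₂ ψ - 2 * (purity₁ ψ + purity₁ (fun b a c d => ψ a b c d)) +
        ‖expectation ψ 1 1 1 1‖ ^ 2 := by
  have h₁ := sum_sq_norm_expectation_pauli₁ hherm htr0 horth ψ
  have h₂ := sum_sq_norm_expectation_pauli₂ hherm htr0 horth ψ
  simp only [purity₂_eq_sum_expectation, purity₁_eq_sum_expectation, expectation_swap₁₂ ψ, h₂,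
    Fin.sum_univ_two, Finset.sum_add_distrib, Finset.sum_sub_distrib, ← Finset.mul_sum, h₁]
  ring

/-- The squared norm of a three-body correlation tensor in terms of purities. -/
theorem threeBody_eq (hherm : ∀ i, (σ i).IsHermitian)
    (htr0 : ∀ i, (σ i).trace = 0)
    (horth : ∀ i j, (σ i * σ j).trace = if i = j then (2 : ℂ) else 0)
    (ψ : Amplitudes) :
    ∑ i, ∑ j, ∑ k, ‖expectation ψ (σ i) (σ j) (σ k) 1‖ ^ 2 =
      8 * purity₃ ψ -
        4 * (purity₂ ψ + purity₂ (fun a c b d => ψ a b c d) + purity₂ (fun b c a d => ψ a b c d)) +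
        2 * (purity₁ ψ + purity₁ (fun b a c d => ψ a b c d) + purity₁ (fun c a b d => ψ a b c d)) -
        ‖expectation ψ 1 1 1 1‖ ^ 2 := by
  have h₁ := sum_sq_norm_expectation_pauli₁ hherm htr0 horth ψ
  have h₂ := sum_sq_norm_expectation_pauli₂ hherm htr0 horth ψ
  have h₃ := sum_sq_norm_expectation_pauli₃ hherm htr0 horth ψ
  have hBC (X Y : Matrix (Fin 2) (Fin 2) ℂ) :
      expectation (fun b c a d => ψ a b c d) X Y 1 1 = expectation ψ 1 X Y 1 :=
    (expectation_swap₂₃ (fun b a c d => ψ a b c d) X 1 Y 1).trans (expectation_swap₁₂ ψ 1 X Y 1)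
  have hC (X : Matrix (Fin 2) (Fin 2) ℂ) :
      expectation (fun c a b d => ψ a b c d) X 1 1 1 = expectation ψ 1 1 X 1 :=
    (expectation_swap₁₂ (fun a c b d => ψ a b c d) 1 X 1 1).trans (expectation_swap₂₃ ψ 1 1 X 1)
  simp only [purity₃_eq_sum_expectation, purity₂_eq_sum_expectation, purity₁_eq_sum_expectation,
    hBC, hC, expectation_swap₁₂ ψ, expectation_swap₂₃ ψ, h₃, h₂, h₁,
    Fin.sum_univ_two, Finset.sum_add_distrib, Finset.sum_sub_distrib, ← Finset.mul_sum]
  ring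

end Pauli

/-- For a pure four-qubit state, the trade-off relation (Eq. (24) of the paper) for the
sum of the six isotropic strengths, which is bounded by 2. -/
theorem four_qubit_strength_tradeoff (σ : Fin 3 → Matrix (Fin 2) (Fin 2) ℂ)
    (hherm : ∀ i, (σ i).IsHermitian)
    (htr0 : ∀ i, (σ i).trace = 0)
    (horth : ∀ i j, (σ i * σ j).trace = if i = j then (2 : ℂ) else 0)
    (ρ : Matrix (Fin 2 × Fin 2 × Fin 2 × Fin 2) (Fin 2 × Fin 2 × Fin 2 × Fin 2) ℂ)
    (hpsd : ρ.PosSemidef) (htr1 : ρ.trace = 1) (hpure : ρ * ρ = ρ) :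
    sAB σ ρ + sAC σ ρ + sAD σ ρ + sBC σ ρ + sCD σ ρ + sBD σ ρ =
      (12 + aSq σ ρ - RBCDsq σ ρ + bSq σ ρ - RACDsq σ ρ + cSq σ ρ - RABDsq σ ρ +
        dSq σ ρ - RABCsq σ ρ) / 6 ∧
    sAB σ ρ + sAC σ ρ + sAD σ ρ + sBC σ ρ + sCD σ ρ + sBD σ ρ ≤ 2 := by
  obtain ⟨v, rfl⟩ := exists_eq_vecMulVec_star hpsd.isHermitian htr1 hpure
  have hT := trace_vecMulVec_mul_kron4 v
  have hone : kron4 1 1 1 1 = 1 := by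
    ext ⟨a, b, c, d⟩ ⟨a', b', c', d'⟩
    simp only [kron4, of_apply, one_apply, Prod.mk.injEq]
    split_ifs <;> simp_all
  have hn := hT 1 1 1 1
  rw [hone, Matrix.mul_one, htr1] at hn
  generalize (fun a b c d => v (a, b, c, d) : Amplitudes) = ψ at hT hn
  have hn' : ‖expectation ψ 1 1 1 1‖ ^ 2 = 1 := by simp [← hn]
  have eB (X : Matrix (Fin 2) (Fin 2) ℂ) :
      expectation ψ 1 X 1 1 = expectation (fun b a c d => ψ a b c d) X 1 1 1 :=
    (expectation_swap₁₂ ψ _ _ _ _).symm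
  have eBC (X Y : Matrix (Fin 2) (Fin 2) ℂ) :
      expectation ψ 1 X Y 1 = expectation (fun b c a d => ψ a b c d) X Y 1 1 :=
    ((expectation_swap₂₃ (fun b a c d => ψ a b c d) _ _ _ _).trans
      (expectation_swap₁₂ ψ _ _ _ _)).symm
  have eBCD (X Y Z : Matrix (Fin 2) (Fin 2) ℂ) :
      expectation ψ 1 X Y Z = expectation (fun b c d a => ψ a b c d) X Y Z 1 :=
    ((expectation_swap₃₄ (fun b c a d => ψ a b c d) _ _ _ _).trans
      ((expectation_swap₂₃ (fun b a c d => ψ a b c d) _ _ _ _).trans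
      (expectation_swap₁₂ ψ _ _ _ _))).symm
  have eAC (X Y : Matrix (Fin 2) (Fin 2) ℂ) :
      expectation ψ X 1 Y 1 = expectation (fun a c b d => ψ a b c d) X Y 1 1 :=
    (expectation_swap₂₃ ψ _ _ _ _).symm
  have eACD (X Y Z : Matrix (Fin 2) (Fin 2) ℂ) :
      expectation ψ X 1 Y Z = expectation (fun a c d b => ψ a b c d) X Y Z 1 :=
    ((expectation_swap₃₄ (fun a c b d => ψ a b c d) _ _ _ _).trans
      (expectation_swap₂₃ ψ _ _ _ _)).symm
  have eABD (X Y Z : Matrix (Fin 2) (Fin 2) ℂ) :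
      expectation ψ X Y 1 Z = expectation (fun a b d c => ψ a b c d) X Y Z 1 :=
    (expectation_swap₃₄ ψ _ _ _ _).symm
  have eAD (X Y : Matrix (Fin 2) (Fin 2) ℂ) :
      expectation ψ X 1 1 Y = expectation (fun a d b c => ψ a b c d) X Y 1 1 :=
    (eABD X 1 Y).trans (expectation_swap₂₃ (fun a b d c => ψ a b c d) _ _ _ _).symm
  have eBD (X Y : Matrix (Fin 2) (Fin 2) ℂ) :
      expectation ψ 1 X 1 Y = expectation (fun b d a c => ψ a b c d) X Y 1 1 :=
    (eBCD X 1 Y).trans ((expectation_swap₂₃ (fun b c d a => ψ a b c d) _ _ _ _).symm.trans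
      (expectation_swap₃₄ (fun b d c a => ψ a b c d) _ _ _ _).symm)
  have eCD (X Y : Matrix (Fin 2) (Fin 2) ℂ) :
      expectation ψ 1 1 X Y = expectation (fun c d a b => ψ a b c d) X Y 1 1 :=
    (eACD 1 X Y).trans ((expectation_swap₁₂ (fun a c d b => ψ a b c d) _ _ _ _).symm.trans
      (expectation_swap₂₃ (fun c a d b => ψ a b c d) _ _ _ _).symm)
  have eC (X : Matrix (Fin 2) (Fin 2) ℂ) :
      expectation ψ 1 1 X 1 = expectation (fun c a b d => ψ a b c d) X 1 1 1 :=
    (eAC 1 X).trans (expectation_swap₁₂ (fun a c b d => ψ a b c d) _ _ _ _).symm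
  have eD (X : Matrix (Fin 2) (Fin 2) ℂ) :
      expectation ψ 1 1 1 X = expectation (fun d a b c => ψ a b c d) X 1 1 1 :=
    (eAD 1 X).trans (expectation_swap₁₂ (fun a d b c => ψ a b c d) _ _ _ _).symm
  have hA := oneBody_eq hherm htr0 horth ψ
  have hB := oneBody_eq hherm htr0 horth (fun b a c d => ψ a b c d)
  have hC := oneBody_eq hherm htr0 horth (fun c a b d => ψ a b c d)
  have hD := oneBody_eq hherm htr0 horth (fun d a b c => ψ a b c d)
  have hAB := twoBody_eq hherm htr0 horth ψ
  have hAC := twoBody_eq hherm htr0 horth (fun a c b d => ψ a b c d)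
  have hAD := twoBody_eq hherm htr0 horth (fun a d b c => ψ a b c d)
  have hBC := twoBody_eq hherm htr0 horth (fun b c a d => ψ a b c d)
  have hBD := twoBody_eq hherm htr0 horth (fun b d a c => ψ a b c d)
  have hCD := twoBody_eq hherm htr0 horth (fun c d a b => ψ a b c d)
  have hABC := threeBody_eq hherm htr0 horth ψ
  have hABD := threeBody_eq hherm htr0 horth (fun a b d c => ψ a b c d)
  have hACD := threeBody_eq hherm htr0 horth (fun a c d b => ψ a b c d)
  have hBCD := threeBody_eq hherm htr0 horth (fun b c d a => ψ a b c d)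
  simp only [← eB, hn'] at hB
  simp only [← eC, hn'] at hC
  simp only [← eD, hn'] at hD
  simp only [← eAC, hn'] at hAC
  simp only [← eAD, hn'] at hAD
  simp only [← eBC, hn'] at hBC
  simp only [← eBD, hn'] at hBD
  simp only [← eCD, hn'] at hCD
  simp only [← eABD, hn'] at hABD
  simp only [← eACD, hn'] at hACD
  simp only [← eBCD, hn'] at hBCD
  have hle := purity₂_sum_le ψ
  simp only [sAB, sAC, sAD, sBC, sBD, sCD, aSq, bSq, cSq, dSq, RABsq, RACsq, RADsq, RBCsq, RBDsq,
    RCDsq, RABCsq, RABDsq, RACDsq, RBCDsq, hT]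
  rw [hA, hB, hC, hD, hAB, hAC, hAD, hBC, hBD, hCD, hABC, hABD, hACD, hBCD, hn',
    purity₃_compl ψ, purity₃_compl (fun b a c d => ψ a b c d),
    purity₃_compl (fun c a b d => ψ a b c d), purity₃_compl (fun d a b c => ψ a b c d),
    purity₁_swap₂₃ ψ, purity₁_swap₃₄ ψ, purity₁_rotate ψ, purity₁_rotate' ψ,
    purity₁_swap₂₃ (fun b a c d => ψ a b c d), purity₁_swap₃₄ (fun b a c d => ψ a b c d),
    purity₁_rotate (fun b a c d => ψ a b c d), purity₁_rotate' (fun b a c d => ψ a b c d),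
    purity₁_swap₂₃ (fun c a b d => ψ a b c d), purity₁_swap₃₄ (fun c a b d => ψ a b c d),
    purity₁_rotate (fun c a b d => ψ a b c d), purity₁_rotate' (fun c a b d => ψ a b c d),
    purity₁_swap₂₃ (fun d a b c => ψ a b c d), purity₁_swap₃₄ (fun d a b c => ψ a b c d),
    purity₁_rotate (fun d a b c => ψ a b c d), purity₁_rotate' (fun d a b c => ψ a b c d),
    purity₂_swap₃₄ ψ, purity₂_swap₃₄ (fun a c b d => ψ a b c d),
    purity₂_swap₃₄ (fun a d b c => ψ a b c d), purity₂_swap₃₄ (fun b c a d => ψ a b c d),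
    purity₂_swap₃₄ (fun b d a c => ψ a b c d), purity₂_swap₃₄ (fun c d a b => ψ a b c d),
    purity₂_compl ψ, purity₂_compl (fun a c b d => ψ a b c d),
    purity₂_compl (fun a d b c => ψ a b c d)]
  constructor <;> linarith only [hle]

end SpinCorrQubit
end

section
/- Let ρ be a pure four-qubit state on ℂ² ⊗ ℂ² ⊗ ℂ² ⊗ ℂ². Then the sum of the squared norms of the four single-party Bloch vectors is bounded by the sum of the squared norms of the four three-body correlation tensors: ‖a‖² + ‖b‖² + ‖c‖² + ‖d‖² ≤ ‖R^{BCD}‖² + ‖R^{ACD}‖² + ‖R^{ABD}‖² + ‖R^{ABC}‖². -/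
open Matrix ComplexOrder

namespace SpinCorrQubit

variable (σ : Fin 3 → Matrix (Fin 2) (Fin 2) ℂ)
variable (ρ : Matrix (Fin 2 × Fin 2 × Fin 2 × Fin 2) (Fin 2 × Fin 2 × Fin 2 × Fin 2) ℂ)

/-- The coefficients of `∑ i, A i ⊗ A i`, an operator on two copies of a qubit. -/
noncomputable def selfTensor {ι : Type*} [Fintype ι] (A : ι → Matrix (Fin 2) (Fin 2) ℂ)
    (p₁ q₁ p₂ q₂ : Fin 2) : ℂ := ∑ i, A i p₁ q₁ * A i p₂ q₂

/-- The coefficients of `X ⊗ X`. -/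
noncomputable abbrev squareTensor (X : Matrix (Fin 2) (Fin 2) ℂ) :
    Fin 2 → Fin 2 → Fin 2 → Fin 2 → ℂ := selfTensor fun _ : Unit => X

/-- The coefficients of the operator exchanging two copies of a qubit. -/
noncomputable def swapTensor (p₁ q₁ p₂ q₂ : Fin 2) : ℂ :=
  (1 : Matrix (Fin 2) (Fin 2) ℂ) p₁ q₂ * (1 : Matrix (Fin 2) (Fin 2) ℂ) p₂ q₁

/-- The expectation `tr((ρ ⊗ ρ) (F₁ ⊗ F₂ ⊗ F₃ ⊗ F₄))`, where each `Fₖ` acts on the two copies of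
the `k`-th party. -/
noncomputable def twoCopy (F₁ F₂ F₃ F₄ : Fin 2 → Fin 2 → Fin 2 → Fin 2 → ℂ) : ℂ :=
  ∑ p, ∑ p', ∑ q, ∑ q', ρ q p * ρ q' p' *
    (F₁ p.1 q.1 p'.1 q'.1 * F₂ p.2.1 q.2.1 p'.2.1 q'.2.1 *
      F₃ p.2.2.1 q.2.2.1 p'.2.2.1 q'.2.2.1 * F₄ p.2.2.2 q.2.2.2 p'.2.2.2 q'.2.2.2)

section Tensors

variable {σ}

/-- Completeness of the Pauli matrices: `∑ i, σ i ⊗ σ i = 2 SWAP - 1`. -/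
lemma selfTensor_eq_two_smul_swap_sub (htr0 : ∀ i, (σ i).trace = 0)
    (horth : ∀ i j, (σ i * σ j).trace = if i = j then (2 : ℂ) else 0) :
    selfTensor σ = (2 : ℂ) • swapTensor - squareTensor 1 := by
  let B : Option (Fin 3) → Matrix (Fin 2) (Fin 2) ℂ := fun o => o.elim 1 σ
  let U : Matrix (Option (Fin 3)) (Fin 2 × Fin 2) ℂ := .of fun o x => B o x.1 x.2
  let V : Matrix (Fin 2 × Fin 2) (Option (Fin 3)) ℂ := .of fun x o => B o x.2 x.1 / 2
  have hUV : U * V = 1 := by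
    have key : ∀ o o', (U * V) o o' = (B o * B o').trace / 2 := by
      intro o o'
      simp [U, V, Matrix.mul_apply, Matrix.trace, Fintype.sum_prod_type]
      ring
    ext o o'
    rw [key]
    rcases o with _ | i <;> rcases o' with _ | j
    · simp [B]
    · simp [B, htr0]
    · simp [B, htr0]
    · simp only [B, Option.elim_some, horth, Matrix.one_apply, Option.some.injEq]
      split_ifs <;> simp
  have hcard : Fintype.card (Option (Fin 3)) = Fintype.card (Fin 2 × Fin 2) := by simp
  have hVU : V * U = 1 := (Matrix.mul_eq_one_comm_of_card_eq _ _ _ hcard).1 hUV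
  funext p q p' q'
  have h := congrFun (congrFun hVU (q, p)) (p', q')
  simp only [V, U, B, Matrix.mul_apply, Matrix.of_apply, Fintype.sum_option, Option.elim_none,
    Option.elim_some, div_mul_eq_mul_div, ← Finset.sum_div] at h
  simp only [selfTensor, swapTensor, Pi.sub_apply, Pi.smul_apply, smul_eq_mul, Matrix.one_apply,
    Prod.mk.injEq, Finset.univ_unique, Finset.sum_singleton] at h ⊢
  have h' : (if p = q' ∧ q = p' then (1 : ℂ) else 0) =
      (if p = q' then 1 else 0) * (if p' = q then 1 else 0) := by
    rw [ite_and]; simp only [eq_comm (a := q)]; split_ifs <;> simp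
  simp only [and_comm (a := q = p'), h'] at h
  linear_combination 2 * h

end Tensors

section TwoCopy

variable {ρ}
variable (F F' F₁ F₂ F₃ F₄ : Fin 2 → Fin 2 → Fin 2 → Fin 2 → ℂ)

lemma twoCopy_smul_sub₁ (c : ℂ) : twoCopy ρ (c • F - F') F₂ F₃ F₄ =
    c * twoCopy ρ F F₂ F₃ F₄ - twoCopy ρ F' F₂ F₃ F₄ := by
  simp only [twoCopy, Finset.mul_sum, ← Finset.sum_sub_distrib, Pi.sub_apply, Pi.smul_apply,
    smul_eq_mul]
  congr! 4
  ring

lemma twoCopy_smul_sub₂ (c : ℂ) : twoCopy ρ F₁ (c • F - F') F₃ F₄ =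
    c * twoCopy ρ F₁ F F₃ F₄ - twoCopy ρ F₁ F' F₃ F₄ := by
  simp only [twoCopy, Finset.mul_sum, ← Finset.sum_sub_distrib, Pi.sub_apply, Pi.smul_apply,
    smul_eq_mul]
  congr! 4
  ring

lemma twoCopy_smul_sub₃ (c : ℂ) : twoCopy ρ F₁ F₂ (c • F - F') F₄ =
    c * twoCopy ρ F₁ F₂ F F₄ - twoCopy ρ F₁ F₂ F' F₄ := by
  simp only [twoCopy, Finset.mul_sum, ← Finset.sum_sub_distrib, Pi.sub_apply, Pi.smul_apply,
    smul_eq_mul]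
  congr! 4
  ring

lemma twoCopy_smul_sub₄ (c : ℂ) : twoCopy ρ F₁ F₂ F₃ (c • F - F') =
    c * twoCopy ρ F₁ F₂ F₃ F - twoCopy ρ F₁ F₂ F₃ F' := by
  simp only [twoCopy, Finset.mul_sum, ← Finset.sum_sub_distrib, Pi.sub_apply, Pi.smul_apply,
    smul_eq_mul]
  congr! 4
  ring

/-- The cyclic shift of the four parties. -/
def cycleParties : Fin 2 × Fin 2 × Fin 2 × Fin 2 ≃ Fin 2 × Fin 2 × Fin 2 × Fin 2 where
  toFun p := (p.2.2.2, p.1, p.2.1, p.2.2.1)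
  invFun p := (p.2.1, p.2.2.1, p.2.2.2, p.1)

lemma twoCopy_submatrix_cycleParties :
    twoCopy (ρ.submatrix cycleParties cycleParties) F₁ F₂ F₃ F₄ = twoCopy ρ F₄ F₁ F₂ F₃ := by
  simp only [twoCopy]
  refine Fintype.sum_equiv cycleParties _ _ fun p => ?_
  refine Fintype.sum_equiv cycleParties _ _ fun p' => ?_
  refine Fintype.sum_equiv cycleParties _ _ fun q => ?_
  refine Fintype.sum_equiv cycleParties _ _ fun q' => ?_
  simp only [Matrix.submatrix_apply, cycleParties, Equiv.coe_fn_mk]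
  ring

/-- All `2 × 2` minors of a pure state vanish. -/
lemma mul_apply_eq_of_pure {n : Type*} [Fintype n] {ρ : Matrix n n ℂ} (hherm : ρ.IsHermitian)
    (htr1 : ρ.trace = 1) (hpure : ρ * ρ = ρ) (p q p' q' : n) :
    ρ p q * ρ p' q' = ρ p q' * ρ p' q := by
  have hmul : ∀ x y, ∑ z, ρ x z * ρ z y = ρ x y := fun x y => by
    rw [← Matrix.mul_apply, hpure]
  have htr : ∑ x, ρ x x = 1 := htr1
  have hstar : ∀ x y, starRingEnd ℂ (ρ x y) = ρ y x := fun x y => hherm.apply y x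
  have hdiag : ∑ p, ∑ p', ∑ q, ∑ q', (ρ p q * ρ q p) * (ρ p' q' * ρ q' p') = 1 := by
    simp_rw [← Finset.mul_sum, hmul, ← Finset.sum_mul, hmul, ← Finset.mul_sum, htr, mul_one, htr]
  have hcross : ∑ p, ∑ p', ∑ q, ∑ q', (ρ p q * ρ q p') * (ρ p' q' * ρ q' p) = 1 := by
    simp_rw [← Finset.mul_sum, hmul, ← Finset.sum_mul, hmul, htr]
  have hdiag' : ∑ p, ∑ p', ∑ q, ∑ q', (ρ p q' * ρ q' p) * (ρ p' q * ρ q p') = 1 := by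
    simp_rw [Finset.sum_comm (f := fun q q' => (ρ _ q' * ρ q' _) * (ρ _ q * ρ q _))]
    exact hdiag
  have hcross' : ∑ p, ∑ p', ∑ q, ∑ q', (ρ p q' * ρ q' p') * (ρ p' q * ρ q p) = 1 := by
    simp_rw [Finset.sum_comm (f := fun q q' => (ρ _ q' * ρ q' _) * (ρ _ q * ρ q _))]
    exact hcross
  have hsum : ∑ p, ∑ p', ∑ q, ∑ q', ‖ρ p q * ρ p' q' - ρ p q' * ρ p' q‖ ^ 2 = 0 := by
    have hexp : ∀ p p' q q', ((‖ρ p q * ρ p' q' - ρ p q' * ρ p' q‖ ^ 2 : ℝ) : ℂ) =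
        (ρ p q * ρ q p) * (ρ p' q' * ρ q' p') + (ρ p q' * ρ q' p) * (ρ p' q * ρ q p') -
          (ρ p q * ρ q p') * (ρ p' q' * ρ q' p) - (ρ p q' * ρ q' p') * (ρ p' q * ρ q p) := by
      intro p p' q q'
      rw [Complex.ofReal_pow, ← Complex.mul_conj']
      simp only [map_sub, map_mul, hstar]
      ring
    apply Complex.ofReal_injective
    simp_rw [Complex.ofReal_sum, hexp, Finset.sum_sub_distrib, Finset.sum_add_distrib, hdiag,
      hdiag', hcross, hcross']
    norm_num
  have hzero : ‖ρ p q * ρ p' q' - ρ p q' * ρ p' q‖ ^ 2 = 0 := by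
    rw [Fintype.sum_eq_zero_iff_of_nonneg fun _ => by positivity] at hsum
    have h₁ := congrFun hsum p
    simp only [Pi.zero_apply] at h₁
    rw [Fintype.sum_eq_zero_iff_of_nonneg fun _ => by positivity] at h₁
    have h₂ := congrFun h₁ p'
    simp only [Pi.zero_apply] at h₂
    rw [Fintype.sum_eq_zero_iff_of_nonneg fun _ => by positivity] at h₂
    have h₃ := congrFun h₂ q
    simp only [Pi.zero_apply] at h₃
    rw [Fintype.sum_eq_zero_iff_of_nonneg fun _ => by positivity] at h₃
    exact congrFun h₃ q'
  exact sub_eq_zero.1 (norm_eq_zero.1 (pow_eq_zero_iff two_ne_zero |>.1 hzero))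

/-- For a pure state, the operator exchanging the two copies of all four parties acts trivially. -/
lemma twoCopy_swap (h : ∀ p q p' q', ρ p q * ρ p' q' = ρ p q' * ρ p' q) :
    twoCopy ρ F₁ F₂ F₃ F₄ =
      twoCopy ρ (fun p q p' q' => F₁ p q' p' q) (fun p q p' q' => F₂ p q' p' q)
        (fun p q p' q' => F₃ p q' p' q) (fun p q p' q' => F₄ p q' p' q) := by
  simp only [twoCopy]
  refine Fintype.sum_congr _ _ fun p => Fintype.sum_congr _ _ fun p' => ?_
  rw [Finset.sum_comm]
  refine Fintype.sum_congr _ _ fun q => Fintype.sum_congr _ _ fun q' => ?_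
  rw [h]
  ring

end TwoCopy

/-- Squared correlations of products of Hermitian families as a two-copy expectation. -/
lemma sum_norm_sq_trace_eq_twoCopy {ρ} (hρ : ρ.IsHermitian) {ι₁ ι₂ ι₃ ι₄ : Type*}
    [Fintype ι₁] [Fintype ι₂] [Fintype ι₃] [Fintype ι₄]
    {A : ι₁ → Matrix (Fin 2) (Fin 2) ℂ} {B : ι₂ → Matrix (Fin 2) (Fin 2) ℂ}
    {C : ι₃ → Matrix (Fin 2) (Fin 2) ℂ} {D : ι₄ → Matrix (Fin 2) (Fin 2) ℂ}
    (hA : ∀ i, (A i).IsHermitian) (hB : ∀ i, (B i).IsHermitian)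
    (hC : ∀ i, (C i).IsHermitian) (hD : ∀ i, (D i).IsHermitian) :
    ((∑ i, ∑ j, ∑ k, ∑ l, ‖(ρ * kron4 (A i) (B j) (C k) (D l)).trace‖ ^ 2 : ℝ) : ℂ) =
      twoCopy ρ (selfTensor A) (selfTensor B) (selfTensor C) (selfTensor D) := by
  have hreal : ∀ i j k l, ((‖(ρ * kron4 (A i) (B j) (C k) (D l)).trace‖ ^ 2 : ℝ) : ℂ) =
      (ρ * kron4 (A i) (B j) (C k) (D l)).trace * (ρ * kron4 (A i) (B j) (C k) (D l)).trace := by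
    intro i j k l
    have hK : (kron4 (A i) (B j) (C k) (D l)).IsHermitian := by
      ext p q
      simp only [Matrix.conjTranspose_apply, kron4, Matrix.of_apply, star_mul', (hA i).apply,
        (hB j).apply, (hC k).apply, (hD l).apply]
    have hz : star (ρ * kron4 (A i) (B j) (C k) (D l)).trace =
        (ρ * kron4 (A i) (B j) (C k) (D l)).trace := by
      rw [← Matrix.trace_conjTranspose, Matrix.conjTranspose_mul, hK.eq, hρ.eq,
        Matrix.trace_mul_comm]
    rw [Complex.ofReal_pow, ← Complex.mul_conj', starRingEnd_apply, hz]
  have htrace : ∀ K, (ρ * K).trace = ∑ p, ∑ q, ρ q p * K p q := fun K => by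
    simp_rw [Matrix.trace, Matrix.diag_apply, Matrix.mul_apply]
    exact Finset.sum_comm
  have hprod : ∀ x : ι₁ × ι₂ × ι₃ × ι₄,
      (ρ * kron4 (A x.1) (B x.2.1) (C x.2.2.1) (D x.2.2.2)).trace *
        (ρ * kron4 (A x.1) (B x.2.1) (C x.2.2.1) (D x.2.2.2)).trace =
      ∑ p, ∑ p', ∑ q, ∑ q', ρ q p * ρ q' p' *
        (A x.1 p.1 q.1 * A x.1 p'.1 q'.1 * (B x.2.1 p.2.1 q.2.1 * B x.2.1 p'.2.1 q'.2.1) *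
          (C x.2.2.1 p.2.2.1 q.2.2.1 * C x.2.2.1 p'.2.2.1 q'.2.2.1) *
          (D x.2.2.2 p.2.2.2 q.2.2.2 * D x.2.2.2 p'.2.2.2 q'.2.2.2)) := by
    intro x
    simp only [htrace, Finset.sum_mul_sum, kron4, Matrix.of_apply]
    congr! 4
    ring
  have hsum : ∀ f : ι₁ → ι₂ → ι₃ → ι₄ → ℂ, ∑ i, ∑ j, ∑ k, ∑ l, f i j k l =
      ∑ x : ι₁ × ι₂ × ι₃ × ι₄, f x.1 x.2.1 x.2.2.1 x.2.2.2 := fun f => by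
    simp only [Fintype.sum_prod_type]
  simp only [Complex.ofReal_sum, hreal]
  rw [hsum, Fintype.sum_congr _ _ hprod, twoCopy, Finset.sum_comm]
  refine Fintype.sum_congr _ _ fun p => ?_
  rw [Finset.sum_comm]
  refine Fintype.sum_congr _ _ fun p' => ?_
  rw [Finset.sum_comm]
  refine Fintype.sum_congr _ _ fun q => ?_
  rw [Finset.sum_comm]
  refine Fintype.sum_congr _ _ fun q' => ?_
  simp only [Fintype.sum_prod_type, ← Finset.mul_sum, ← Finset.sum_mul, selfTensor]

section Pure

variable {σ ρ}

/-- The triangle inequality for sums of squared norms. -/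
lemma sum_norm_add_sq_le {ι : Type*} [Fintype ι] {u v : ι → ℂ} {c n m : ℝ} (hn : 0 ≤ n)
    (hm : 0 ≤ m) (hc : 0 ≤ c) (hu : ∑ i, ‖u i‖ ^ 2 = c * n ^ 2) (hv : ∑ i, ‖v i‖ ^ 2 = c * m ^ 2) :
    ∑ i, ‖u i + v i‖ ^ 2 ≤ c * (n + m) ^ 2 := by
  have hcs := Finset.sum_mul_sq_le_sq_mul_sq Finset.univ (fun i => ‖u i‖) (fun i => ‖v i‖)
  rw [hu, hv] at hcs
  have hcross : ∑ i, ‖u i‖ * ‖v i‖ ≤ c * (n * m) :=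
    le_of_sq_le_sq (hcs.trans_eq (by ring)) (by positivity)
  calc ∑ i, ‖u i + v i‖ ^ 2 ≤ ∑ i, (‖u i‖ ^ 2 + ‖v i‖ ^ 2 + 2 * (‖u i‖ * ‖v i‖)) := by
        refine Finset.sum_le_sum fun i _ => ?_
        have := pow_le_pow_left₀ (norm_nonneg _) (norm_add_le (u i) (v i)) 2
        linarith [this]
    _ = c * n ^ 2 + c * m ^ 2 + 2 * ∑ i, ‖u i‖ * ‖v i‖ := by
        rw [Finset.sum_add_distrib, Finset.sum_add_distrib, hu, hv, Finset.mul_sum]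
    _ ≤ c * (n + m) ^ 2 := by linarith

lemma trace_mul_kron4_single (d : Fin 2) : (ρ * kron4 1 1 1 (Matrix.single d d 1)).trace =
    ∑ p, if p.2.2.2 = d then ρ p p else 0 := by
  have hK : ∀ q p, kron4 1 1 1 (Matrix.single d d 1) q p =
      if q = p then (if p.2.2.2 = d then 1 else 0) else 0 := by
    rintro ⟨a, b, c, e⟩ ⟨a', b', c', e'⟩
    simp only [kron4, Matrix.of_apply, Matrix.one_apply, Matrix.single_apply, Prod.mk.injEq]
    split_ifs <;> grind
  simp [Matrix.trace, Matrix.mul_apply, hK]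

lemma kron4_eq_add_single (A B C : Matrix (Fin 2) (Fin 2) ℂ) :
    kron4 A B C 1 = kron4 A B C (Matrix.single 0 0 1) + kron4 A B C (Matrix.single 1 1 1) := by
  ext p q
  have : (1 : Matrix (Fin 2) (Fin 2) ℂ) = Matrix.single 0 0 1 + Matrix.single 1 1 1 := by
    ext i j
    fin_cases i <;> fin_cases j <;> simp
  simp only [kron4, Matrix.of_apply, Matrix.add_apply, this]
  ring

/-- The outcome probabilities of measuring the last party add up to at most one. -/
lemma norm_trace_single_add_le (hpsd : ρ.PosSemidef) (htr1 : ρ.trace = 1) :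
    ‖(ρ * kron4 1 1 1 (Matrix.single 0 0 1)).trace‖ +
      ‖(ρ * kron4 1 1 1 (Matrix.single 1 1 1)).trace‖ ≤ 1 := by
  rw [trace_mul_kron4_single, trace_mul_kron4_single]
  refine (add_le_add (norm_sum_le _ _) (norm_sum_le _ _)).trans ?_
  rw [← Finset.sum_add_distrib]
  have hp : ∀ p, ‖if p.2.2.2 = 0 then ρ p p else 0‖ + ‖if p.2.2.2 = 1 then ρ p p else 0‖ =
      ‖ρ p p‖ := by
    rintro ⟨a, b, c, e⟩
    fin_cases e <;> simp
  rw [Fintype.sum_congr _ _ hp]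
  refine le_of_eq (Complex.ofReal_injective ?_)
  rw [Complex.ofReal_sum, Complex.ofReal_one, ← htr1]
  exact Fintype.sum_congr _ _ fun p => (Complex.eq_coe_norm_of_nonneg hpsd.diag_nonneg).symm

/-- The two-body correlations of the first three parties, weighted by `X` on the last party. -/
noncomputable def pairCorrelation (σ : Fin 3 → Matrix (Fin 2) (Fin 2) ℂ)
    (ρ : Matrix (Fin 2 × Fin 2 × Fin 2 × Fin 2) (Fin 2 × Fin 2 × Fin 2 × Fin 2) ℂ)
    (X : Matrix (Fin 2) (Fin 2) ℂ) :
    (Fin 3 × Fin 3) ⊕ (Fin 3 × Fin 3) ⊕ (Fin 3 × Fin 3) → ℂ :=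
  Sum.elim (fun i => (ρ * kron4 (σ i.1) (σ i.2) 1 X).trace) <|
    Sum.elim (fun i => (ρ * kron4 (σ i.1) 1 (σ i.2) X).trace)
      (fun i => (ρ * kron4 1 (σ i.1) (σ i.2) X).trace)

lemma sum_norm_sq_pairCorrelation (hherm : ∀ i, (σ i).IsHermitian) (hρ : ρ.IsHermitian)
    {X : Matrix (Fin 2) (Fin 2) ℂ} (hX : X.IsHermitian) :
    ((∑ i, ‖pairCorrelation σ ρ X i‖ ^ 2 : ℝ) : ℂ) =
      twoCopy ρ (selfTensor σ) (selfTensor σ) (squareTensor 1) (squareTensor X) +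
      twoCopy ρ (selfTensor σ) (squareTensor 1) (selfTensor σ) (squareTensor X) +
      twoCopy ρ (squareTensor 1) (selfTensor σ) (selfTensor σ) (squareTensor X) := by
  have h1 : ∀ _ : Unit, (1 : Matrix (Fin 2) (Fin 2) ℂ).IsHermitian := fun _ => isHermitian_one
  have hX' : ∀ _ : Unit, X.IsHermitian := fun _ => hX
  rw [squareTensor, squareTensor, ← sum_norm_sq_trace_eq_twoCopy hρ hherm hherm h1 hX',
    ← sum_norm_sq_trace_eq_twoCopy hρ hherm h1 hherm hX',
    ← sum_norm_sq_trace_eq_twoCopy hρ h1 hherm hherm hX']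
  simp [pairCorrelation, Fintype.sum_prod_type, add_assoc]

/-- A pure state of three qubits has total squared two-body correlation three. -/
lemma sum_norm_sq_pairCorrelation_single (hherm : ∀ i, (σ i).IsHermitian)
    (hσ : selfTensor σ = (2 : ℂ) • swapTensor - squareTensor 1) (hρ : ρ.IsHermitian)
    (hminor : ∀ p q p' q', ρ p q * ρ p' q' = ρ p q' * ρ p' q) (d : Fin 2) :
    ∑ i, ‖pairCorrelation σ ρ (Matrix.single d d 1) i‖ ^ 2 =
      3 * ‖(ρ * kron4 1 1 1 (Matrix.single d d 1)).trace‖ ^ 2 := by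
  have h1 : ∀ _ : Unit, (1 : Matrix (Fin 2) (Fin 2) ℂ).IsHermitian := fun _ => isHermitian_one
  have hX : (Matrix.single d d (1 : ℂ)).IsHermitian := by
    simp [Matrix.IsHermitian, Matrix.conjTranspose_single]
  have hn := sum_norm_sq_trace_eq_twoCopy hρ h1 h1 h1 (fun _ : Unit => hX)
  simp only [Finset.univ_unique, Finset.sum_singleton] at hn
  have hswap : (fun p q p' q' => swapTensor p q' p' q) = squareTensor 1 := by
    funext p q p' q'; simp [swapTensor, selfTensor]
  have hone : (fun p q p' q' => squareTensor 1 p q' p' q) = swapTensor := by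
    funext p q p' q'; simp [swapTensor, selfTensor]
  have hsingle : (fun p q p' q' => squareTensor (Matrix.single d d 1) p q' p' q) =
      squareTensor (Matrix.single d d 1) := by
    have hs : ∀ p q, Matrix.single d d (1 : ℂ) p q =
        (if d = p then 1 else 0) * (if d = q then 1 else 0) := by
      simp only [Matrix.single_apply]
      grind
    funext p q p' q'
    simp only [selfTensor, hs, Finset.univ_unique, Finset.sum_singleton]
    ring
  have e₁ := twoCopy_swap swapTensor swapTensor (squareTensor 1)
    (squareTensor (Matrix.single d d 1)) hminor
  have e₂ := twoCopy_swap swapTensor (squareTensor 1) swapTensor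
    (squareTensor (Matrix.single d d 1)) hminor
  have e₃ := twoCopy_swap (squareTensor 1) swapTensor swapTensor
    (squareTensor (Matrix.single d d 1)) hminor
  rw [hswap, hone, hsingle] at e₁ e₂ e₃
  apply Complex.ofReal_injective
  rw [sum_norm_sq_pairCorrelation hherm hρ hX, Complex.ofReal_mul, hn, hσ]
  simp only [twoCopy_smul_sub₁, twoCopy_smul_sub₂, twoCopy_smul_sub₃, e₁, e₂, e₃]
  push_cast
  ring

lemma twoCopy_one (hρ : ρ.IsHermitian) (htr1 : ρ.trace = 1) :
    twoCopy ρ (squareTensor 1) (squareTensor 1) (squareTensor 1) (squareTensor 1) = 1 := by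
  have h1 : ∀ _ : Unit, (1 : Matrix (Fin 2) (Fin 2) ℂ).IsHermitian := fun _ => isHermitian_one
  have hK : kron4 1 1 1 1 = 1 := by
    ext ⟨a, b, c, e⟩ ⟨a', b', c', e'⟩
    simp only [kron4, Matrix.of_apply, Matrix.one_apply, Prod.mk.injEq]
    grind
  rw [squareTensor, ← sum_norm_sq_trace_eq_twoCopy hρ h1 h1 h1 h1]
  simp [hK, htr1]

/-- In a pure four-qubit state, the purities of the three pairs among the first three parties add
up to at most the purities of these parties. -/
lemma twoCopy_pair_le_twoCopy_single (hherm : ∀ i, (σ i).IsHermitian)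
    (hσ : selfTensor σ = (2 : ℂ) • swapTensor - squareTensor 1)
    (hpsd : ρ.PosSemidef) (htr1 : ρ.trace = 1) (hpure : ρ * ρ = ρ) :
    (twoCopy ρ swapTensor swapTensor (squareTensor 1) (squareTensor 1)).re +
      (twoCopy ρ swapTensor (squareTensor 1) swapTensor (squareTensor 1)).re +
      (twoCopy ρ (squareTensor 1) swapTensor swapTensor (squareTensor 1)).re ≤
    (twoCopy ρ swapTensor (squareTensor 1) (squareTensor 1) (squareTensor 1)).re +
      (twoCopy ρ (squareTensor 1) swapTensor (squareTensor 1) (squareTensor 1)).re +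
      (twoCopy ρ (squareTensor 1) (squareTensor 1) swapTensor (squareTensor 1)).re := by
  have hρ := hpsd.isHermitian
  have hminor := mul_apply_eq_of_pure hρ htr1 hpure
  have hadd : ∀ i, pairCorrelation σ ρ 1 i = pairCorrelation σ ρ (Matrix.single 0 0 1) i +
      pairCorrelation σ ρ (Matrix.single 1 1 1) i := by
    rintro (i | i | i) <;>
      simp only [pairCorrelation, Sum.elim_inl, Sum.elim_inr] <;>
      rw [kron4_eq_add_single, Matrix.mul_add, Matrix.trace_add]
  have hle : ∑ i, ‖pairCorrelation σ ρ 1 i‖ ^ 2 ≤ 3 := by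
    simp_rw [hadd]
    refine (sum_norm_add_sq_le (norm_nonneg _) (norm_nonneg _) (by norm_num)
      (sum_norm_sq_pairCorrelation_single hherm hσ hρ hminor 0)
      (sum_norm_sq_pairCorrelation_single hherm hσ hρ hminor 1)).trans ?_
    have := pow_le_one₀ (n := 2) (by positivity) (norm_trace_single_add_le hpsd htr1)
    linarith
  have h := congrArg Complex.re (sum_norm_sq_pairCorrelation hherm hρ
    (isHermitian_one (n := Fin 2) (α := ℂ)))
  rw [hσ] at h
  simp only [twoCopy_smul_sub₁, twoCopy_smul_sub₂, twoCopy_smul_sub₃, twoCopy_one hρ htr1,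
    Complex.ofReal_re, Complex.add_re, Complex.sub_re, Complex.mul_re, Complex.re_ofNat,
    Complex.im_ofNat, Complex.one_re, zero_mul, sub_zero] at h
  linarith

end Pure


/-- For a pure four-qubit state, the sum of the squared norms of the four single-party
Bloch vectors is bounded by the sum of the squared norms of the four three-body
correlation tensors (Eq. (25) of the paper). -/
theorem four_qubit_bloch_vs_three_body (σ : Fin 3 → Matrix (Fin 2) (Fin 2) ℂ)
    (hherm : ∀ i, (σ i).IsHermitian)
    (htr0 : ∀ i, (σ i).trace = 0)
    (horth : ∀ i j, (σ i * σ j).trace = if i = j then (2 : ℂ) else 0)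
    (ρ : Matrix (Fin 2 × Fin 2 × Fin 2 × Fin 2) (Fin 2 × Fin 2 × Fin 2 × Fin 2) ℂ)
    (hpsd : ρ.PosSemidef) (htr1 : ρ.trace = 1) (hpure : ρ * ρ = ρ) :
    aSq σ ρ + bSq σ ρ + cSq σ ρ + dSq σ ρ ≤
      RBCDsq σ ρ + RACDsq σ ρ + RABDsq σ ρ + RABCsq σ ρ := by
  have hρ := hpsd.isHermitian
  have hminor := mul_apply_eq_of_pure hρ htr1 hpure
  have hσ := selfTensor_eq_two_smul_swap_sub htr0 horth
  have h1 : ∀ _ : Unit, (1 : Matrix (Fin 2) (Fin 2) ℂ).IsHermitian := fun _ => isHermitian_one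
  let shift (τ : Matrix (Fin 2 × Fin 2 × Fin 2 × Fin 2) (Fin 2 × Fin 2 × Fin 2 × Fin 2) ℂ) :=
    τ.submatrix cycleParties cycleParties
  have hshift : ∀ τ : Matrix (Fin 2 × Fin 2 × Fin 2 × Fin 2) (Fin 2 × Fin 2 × Fin 2 × Fin 2) ℂ,
      τ.PosSemidef ∧ τ.trace = 1 ∧ τ * τ = τ →
        (shift τ).PosSemidef ∧ (shift τ).trace = 1 ∧ shift τ * shift τ = shift τ := by
    rintro τ ⟨h, ht, hp⟩
    refine ⟨h.submatrix _, ?_, ?_⟩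
    · rw [← ht]
      exact Equiv.sum_comp cycleParties fun p => τ p p
    · simp only [shift]
      rw [Matrix.submatrix_mul_equiv, hp]
  have h₀ := And.intro hpsd (And.intro htr1 hpure)
  have h₁ := hshift _ h₀
  have h₂ := hshift _ h₁
  have h₃ := hshift _ h₂
  have t₀ := twoCopy_pair_le_twoCopy_single hherm hσ h₀.1 h₀.2.1 h₀.2.2
  have t₁ := twoCopy_pair_le_twoCopy_single hherm hσ h₁.1 h₁.2.1 h₁.2.2
  have t₂ := twoCopy_pair_le_twoCopy_single hherm hσ h₂.1 h₂.2.1 h₂.2.2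
  have t₃ := twoCopy_pair_le_twoCopy_single hherm hσ h₃.1 h₃.2.1 h₃.2.2
  simp only [shift, twoCopy_submatrix_cycleParties] at t₁ t₂ t₃
  have hswap : (fun p q p' q' => swapTensor p q' p' q) = squareTensor 1 := by
    funext p q p' q'; simp [swapTensor, selfTensor]
  have hone : (fun p q p' q' => squareTensor 1 p q' p' q) = swapTensor := by
    funext p q p' q'; simp [swapTensor, selfTensor]
  have eA := twoCopy_swap (squareTensor 1) swapTensor swapTensor swapTensor hminor
  have eB := twoCopy_swap swapTensor (squareTensor 1) swapTensor swapTensor hminor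
  have eC := twoCopy_swap swapTensor swapTensor (squareTensor 1) swapTensor hminor
  have eD := twoCopy_swap swapTensor swapTensor swapTensor (squareTensor 1) hminor
  rw [hswap, hone] at eA eB eC eD
  have rA := sum_norm_sq_trace_eq_twoCopy hρ hherm h1 h1 h1
  have rB := sum_norm_sq_trace_eq_twoCopy hρ h1 hherm h1 h1
  have rC := sum_norm_sq_trace_eq_twoCopy hρ h1 h1 hherm h1
  have rD := sum_norm_sq_trace_eq_twoCopy hρ h1 h1 h1 hherm
  have rBCD := sum_norm_sq_trace_eq_twoCopy hρ h1 hherm hherm hherm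
  have rACD := sum_norm_sq_trace_eq_twoCopy hρ hherm h1 hherm hherm
  have rABD := sum_norm_sq_trace_eq_twoCopy hρ hherm hherm h1 hherm
  have rABC := sum_norm_sq_trace_eq_twoCopy hρ hherm hherm hherm h1
  apply_fun Complex.re at rA rB rC rD rBCD rACD rABD rABC
  simp only [hσ, twoCopy_smul_sub₁, twoCopy_smul_sub₂, twoCopy_smul_sub₃, twoCopy_smul_sub₄,
    twoCopy_one hρ htr1, eA, eB, eC, eD, Complex.ofReal_re, Complex.sub_re, Complex.mul_re,
    Complex.re_ofNat, Complex.im_ofNat, Complex.one_re, zero_mul, sub_zero, Finset.univ_unique,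
    Finset.sum_singleton] at rA rB rC rD rBCD rACD rABD rABC
  unfold aSq bSq cSq dSq RBCDsq RACDsq RABDsq RABCsq
  linarith

end SpinCorrQubit
end

section
/- (Lemma 4.1, part 1) Let |ψ⟩ be a fully separable pure four-qudit state, |ψ⟩ = |ψ_1⟩ ⊗ |ψ_2⟩ ⊗ |ψ_3⟩ ⊗ |ψ_4⟩ with each |ψ_t⟩ a unit vector in ℂ^d, and let ρ = |ψ⟩⟨ψ|. Then for every integer k with 1 ≤ k ≤ (d²−1)², the Ky Fan k-norm of the realigned matrix M^{(AB)(CD)} satisfies ‖M^{(AB)(CD)}‖_k ≤ (d−1)². -/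
open Matrix ComplexOrder

namespace SpinCorrGME

/-- The singular values of a square complex matrix `S`, indexed by the row type:
the square roots of the eigenvalues of the positive semidefinite matrix `Sᴴ * S`. -/
noncomputable def singularValues {n : Type*} [Fintype n] [DecidableEq n]
    (S : Matrix n n ℂ) : n → ℝ :=
  fun i => Real.sqrt ((Matrix.posSemidef_conjTranspose_mul_self S).isHermitian.eigenvalues i)

/-- The Ky Fan `k`-norm of a square complex matrix: the sum of its `k` largest singular
values, expressed as the maximum of `∑ i ∈ t, σ_i` over all subsets `t` of cardinality
`k` (and `0` if `k` exceeds the size of the matrix). -/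
noncomputable def kyFan {n : Type*} [Fintype n] [DecidableEq n] (k : ℕ)
    (S : Matrix n n ℂ) : ℝ :=
  if h : (Finset.powersetCard k (Finset.univ : Finset n)).Nonempty then
    (Finset.powersetCard k (Finset.univ : Finset n)).sup' h
      (fun t => ∑ i ∈ t, singularValues S i)
  else 0

variable {d : ℕ}

/-- Tensor (Kronecker) product of four `d × d` matrices, acting on `(ℂ^d)^{⊗4}`. -/
noncomputable def kron4 (A B C D : Matrix (Fin d) (Fin d) ℂ) :
    Matrix (Fin d × Fin d × Fin d × Fin d) (Fin d × Fin d × Fin d × Fin d) ℂ :=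
  Matrix.of fun p q =>
    A p.1 q.1 * B p.2.1 q.2.1 * C p.2.2.1 q.2.2.1 * D p.2.2.2 q.2.2.2

/-- The rank-one projector `|ψ⟩⟨ψ|` onto a vector of `(ℂ^d)^{⊗4}`. -/
noncomputable def outer (ψ : Fin d × Fin d × Fin d × Fin d → ℂ) :
    Matrix (Fin d × Fin d × Fin d × Fin d) (Fin d × Fin d × Fin d × Fin d) ℂ :=
  Matrix.of fun p q => ψ p * (starRingEnd ℂ) (ψ q)

/-- A vector is normalized (a unit vector). -/
def unitNorm {α : Type*} [Fintype α] (v : α → ℂ) : Prop := ∑ x, ‖v x‖ ^ 2 = 1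

variable (lam : Fin (d ^ 2 - 1) → Matrix (Fin d) (Fin d) ℂ)
variable (ρ : Matrix (Fin d × Fin d × Fin d × Fin d) (Fin d × Fin d × Fin d × Fin d) ℂ)

/-- The realignment `M^{(AB)(CD)}` of the four-body correlation tensor
`R^{ABCD}_{ijlm} = tr(ρ · λ_i ⊗ λ_j ⊗ λ_l ⊗ λ_m)`: rows indexed by `(i,j)`,
columns indexed by `(l,m)`. -/
noncomputable def MABCD :
    Matrix (Fin (d ^ 2 - 1) × Fin (d ^ 2 - 1)) (Fin (d ^ 2 - 1) × Fin (d ^ 2 - 1)) ℂ :=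
  Matrix.of fun p q => (ρ * kron4 (lam p.1) (lam p.2) (lam q.1) (lam q.2)).trace

/-- The realignment `M^{(AC)(BD)}`: rows indexed by `(i,l)`, columns by `(j,m)`. -/
noncomputable def MACBD :
    Matrix (Fin (d ^ 2 - 1) × Fin (d ^ 2 - 1)) (Fin (d ^ 2 - 1) × Fin (d ^ 2 - 1)) ℂ :=
  Matrix.of fun p q => (ρ * kron4 (lam p.1) (lam q.1) (lam p.2) (lam q.2)).trace

/-- The realignment `M^{(AD)(BC)}`: rows indexed by `(i,m)`, columns by `(j,l)`. -/
noncomputable def MADBC :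
    Matrix (Fin (d ^ 2 - 1) × Fin (d ^ 2 - 1)) (Fin (d ^ 2 - 1) × Fin (d ^ 2 - 1)) ℂ :=
  Matrix.of fun p q => (ρ * kron4 (lam p.1) (lam q.1) (lam q.2) (lam p.2)).trace

/-- `kron4` as an iterated Kronecker product. -/
theorem kron4_eq_kronecker {d : ℕ} (A B C D : Matrix (Fin d) (Fin d) ℂ) :
    kron4 A B C D =
      kroneckerMap (· * ·) A (kroneckerMap (· * ·) B (kroneckerMap (· * ·) C D)) := by
  ext p q
  simp [kron4, mul_assoc]

theorem trace_kron4_mul_kron4 {d : ℕ} (A B C D A' B' C' D' : Matrix (Fin d) (Fin d) ℂ) :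
    (kron4 A B C D * kron4 A' B' C' D').trace =
      (A * A').trace * (B * B').trace * ((C * C').trace * (D * D').trace) := by
  simp only [kron4_eq_kronecker, ← mul_kronecker_mul, trace_kronecker]
  ring

/-- The projector onto a product vector is the tensor product of the projectors. -/
theorem outer_product_eq_kron4 {d : ℕ} (ψ₁ ψ₂ ψ₃ ψ₄ : Fin d → ℂ) :
    outer (fun p => ψ₁ p.1 * ψ₂ p.2.1 * ψ₃ p.2.2.1 * ψ₄ p.2.2.2) =
      kron4 (vecMulVec ψ₁ (star ψ₁)) (vecMulVec ψ₂ (star ψ₂))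
        (vecMulVec ψ₃ (star ψ₃)) (vecMulVec ψ₄ (star ψ₄)) := by
  ext p q
  simp only [outer, kron4, of_apply, vecMulVec_apply, Pi.star_apply, map_mul, starRingEnd_apply]
  ring

/-- Bessel's inequality for the Bloch vector of a state of trace and purity one. -/
theorem sum_norm_sq_trace_mul_le {d : ℕ} (hd : d ≠ 0) {ι : Type*} [Fintype ι] [DecidableEq ι]
    (lam : ι → Matrix (Fin d) (Fin d) ℂ)
    (hherm : ∀ i, (lam i).IsHermitian)
    (htr0 : ∀ i, (lam i).trace = 0)
    (horth : ∀ i j, (lam i * lam j).trace = if i = j then (d : ℂ) else 0)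
    {P : Matrix (Fin d) (Fin d) ℂ} (hP : P.IsHermitian) (hP1 : P.trace = 1)
    (hP2 : (P * P).trace = 1) :
    ∑ i, ‖(P * lam i).trace‖ ^ 2 ≤ (d : ℝ) - 1 := by
  have hd' : (d : ℂ) ≠ 0 := by exact_mod_cast hd
  set c : ι → ℂ := fun i => (P * lam i).trace with hc
  have hcreal : ∀ i, star (c i) = c i := fun i => by
    rw [hc]
    dsimp only
    rw [← trace_conjTranspose, conjTranspose_mul, hP.eq, (hherm i).eq, trace_mul_comm]
  set N : ℝ := ∑ i, ‖c i‖ ^ 2 with hN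
  have hNc : ∑ i, c i * c i = (N : ℂ) := by
    rw [hN]
    push_cast
    refine Finset.sum_congr rfl fun i _ => ?_
    rw [← Complex.mul_conj']
    exact congrArg (c i * ·) (hcreal i).symm
  set S : Matrix (Fin d) (Fin d) ℂ := ∑ i, c i • lam i with hS
  have hSherm : Sᴴ = S := by
    simp only [hS, conjTranspose_sum, conjTranspose_smul, hcreal, (hherm _).eq]
  have hS0 : S.trace = 0 := by simp [hS, trace_sum, htr0]
  have hPS : (P * S).trace = N := by
    simp only [hS, Finset.mul_sum, trace_sum, mul_smul_comm, trace_smul, smul_eq_mul]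
    exact hNc
  have hSS : (S * S).trace = d * N := by
    simp only [hS, Finset.mul_sum, Finset.sum_mul, trace_sum, mul_smul_comm, smul_mul_assoc,
      trace_smul, smul_eq_mul, horth, mul_ite, mul_zero, Finset.sum_ite_eq', Finset.mem_univ,
      if_true]
    rw [← hNc, Finset.mul_sum]
    exact Finset.sum_congr rfl fun i _ => by ring
  set Q : Matrix (Fin d) (Fin d) ℂ := (d : ℂ) • P - 1 - S with hQ
  have hQherm : Qᴴ = Q := by
    simp [hQ, hSherm, hP.eq]
  have hQQ : (Qᴴ * Q).trace = ((d * (d - 1 - N) : ℝ) : ℂ) := by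
    rw [hQherm, hQ]
    simp only [sub_mul, mul_sub, smul_mul_assoc, mul_smul_comm, trace_sub, trace_smul, one_mul,
      mul_one, smul_eq_mul, trace_mul_comm S P, hPS, hSS, hS0, hP1, hP2, trace_one,
      Fintype.card_fin]
    push_cast
    ring
  have h0 : (0 : ℂ) ≤ (Qᴴ * Q).trace := (posSemidef_conjTranspose_mul_self Q).trace_nonneg
  rw [hQQ] at h0
  have h0' : 0 ≤ (d : ℝ) * (d - 1 - N) := by exact_mod_cast h0
  have hdpos : (0 : ℝ) < d := by exact_mod_cast Nat.pos_of_ne_zero hd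
  have := nonneg_of_mul_nonneg_right h0' hdpos
  linarith

theorem sum_norm_sq_trace_projector_mul_le {d : ℕ} (hd : d ≠ 0) {ι : Type*} [Fintype ι]
    [DecidableEq ι] (lam : ι → Matrix (Fin d) (Fin d) ℂ)
    (hherm : ∀ i, (lam i).IsHermitian)
    (htr0 : ∀ i, (lam i).trace = 0)
    (horth : ∀ i j, (lam i * lam j).trace = if i = j then (d : ℂ) else 0)
    {ψ : Fin d → ℂ} (hψ : unitNorm ψ) :
    ∑ i, ‖(vecMulVec ψ (star ψ) * lam i).trace‖ ^ 2 ≤ (d : ℝ) - 1 := by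
  have hdot : star ψ ⬝ᵥ ψ = 1 := by
    have h : ((∑ x, ‖ψ x‖ ^ 2 : ℝ) : ℂ) = 1 := by rw [hψ, Complex.ofReal_one]
    rw [← h]
    push_cast
    exact Finset.sum_congr rfl fun x _ => Complex.conj_mul' (ψ x)
  have htr : (vecMulVec ψ (star ψ)).trace = 1 := by
    rw [trace_vecMulVec, dotProduct_comm, hdot]
  refine sum_norm_sq_trace_mul_le hd lam hherm htr0 horth ?_ htr ?_
  · rw [IsHermitian, conjTranspose_vecMulVec, star_star]
  · rw [vecMulVec_mul_vecMulVec, hdot, one_smul, htr]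

/-- A matrix of rank at most one has at most one nonzero singular value, so their sum is the
Frobenius norm. -/
theorem sum_singularValues_le_of_rank_le_one {n : Type*} [Fintype n] [DecidableEq n]
    {S : Matrix n n ℂ} (hS : S.rank ≤ 1) (t : Finset n) :
    ∑ i ∈ t, singularValues S i ≤ Real.sqrt (Sᴴ * S).trace.re := by
  set hpsd := posSemidef_conjTranspose_mul_self S
  set μ := hpsd.isHermitian.eigenvalues with hμ
  have hμ0 : ∀ i, 0 ≤ μ i := hpsd.eigenvalues_nonneg
  have htr : (Sᴴ * S).trace.re = ∑ i, μ i := by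
    rw [hpsd.isHermitian.trace_eq_sum_eigenvalues]
    simp [hμ]
  have hcard : Fintype.card {i // μ i ≠ 0} ≤ 1 := by
    rw [← hpsd.isHermitian.rank_eq_card_non_zero_eigs, rank_conjTranspose_mul_self]
    exact hS
  rw [htr]
  change ∑ i ∈ t, Real.sqrt (μ i) ≤ _
  by_cases h : ∃ j ∈ t, μ j ≠ 0
  · obtain ⟨j, hj, hj0⟩ := h
    rw [Finset.sum_eq_single_of_mem j hj]
    · exact Real.sqrt_le_sqrt (Finset.single_le_sum (fun i _ => hμ0 i) (Finset.mem_univ j))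
    · intro i _ hij
      by_contra hi
      have hi0 : μ i ≠ 0 := fun h0 => hi (by rw [h0, Real.sqrt_zero])
      exact hij (congrArg Subtype.val
        (Fintype.card_le_one_iff.mp hcard ⟨i, hi0⟩ ⟨j, hj0⟩))
  · push Not at h
    rw [Finset.sum_eq_zero fun i hi => by rw [h i hi, Real.sqrt_zero]]
    exact Real.sqrt_nonneg _

theorem re_trace_conjTranspose_mul_self_vecMulVec {n : Type*} [Fintype n] (a b : n → ℂ) :
    ((vecMulVec a b)ᴴ * vecMulVec a b).trace.re = (∑ i, ‖a i‖ ^ 2) * ∑ i, ‖b i‖ ^ 2 := by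
  have h : ((vecMulVec a b)ᴴ * vecMulVec a b).trace =
      (((∑ i, ‖a i‖ ^ 2) * ∑ i, ‖b i‖ ^ 2 : ℝ) : ℂ) := by
    rw [conjTranspose_vecMulVec, vecMulVec_mul_vecMulVec, trace_vecMulVec, dotProduct_smul,
      smul_eq_mul]
    push_cast
    congr 1
    · exact Finset.sum_congr rfl fun x _ => Complex.conj_mul' (a x)
    · exact Finset.sum_congr rfl fun x _ => Complex.conj_mul' (b x)
  rw [h, Complex.ofReal_re]

theorem kyFan_vecMulVec_le {n : Type*} [Fintype n] [DecidableEq n] (k : ℕ) (a b : n → ℂ) :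
    kyFan k (vecMulVec a b) ≤ Real.sqrt ((∑ i, ‖a i‖ ^ 2) * ∑ i, ‖b i‖ ^ 2) := by
  unfold kyFan
  split_ifs with h
  · refine Finset.sup'_le _ _ fun t _ => ?_
    rw [← re_trace_conjTranspose_mul_self_vecMulVec]
    exact sum_singularValues_le_of_rank_le_one (rank_vecMulVec_le a b) t
  · exact Real.sqrt_nonneg _

theorem sum_norm_sq_mul_prod_le {ι : Type*} [Fintype ι] {f g : ι → ℂ} {r : ℝ}
    (hf : ∑ i, ‖f i‖ ^ 2 ≤ r) (hg : ∑ i, ‖g i‖ ^ 2 ≤ r) :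
    ∑ p : ι × ι, ‖f p.1 * g p.2‖ ^ 2 ≤ r ^ 2 := by
  simp only [norm_mul, mul_pow, Fintype.sum_prod_type, ← Finset.mul_sum, ← Finset.sum_mul]
  have hg0 : 0 ≤ ∑ i, ‖g i‖ ^ 2 := Finset.sum_nonneg fun i _ => by positivity
  rw [sq r]
  exact mul_le_mul hf hg hg0 (hg0.trans hg)

theorem kyFan_vecMulVec_prod_le {ι : Type*} [Fintype ι] [DecidableEq ι] (k : ℕ)
    {f₁ f₂ f₃ f₄ : ι → ℂ} {r : ℝ} (h₁ : ∑ i, ‖f₁ i‖ ^ 2 ≤ r) (h₂ : ∑ i, ‖f₂ i‖ ^ 2 ≤ r)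
    (h₃ : ∑ i, ‖f₃ i‖ ^ 2 ≤ r) (h₄ : ∑ i, ‖f₄ i‖ ^ 2 ≤ r) :
    kyFan k (vecMulVec (fun p : ι × ι => f₁ p.1 * f₂ p.2) (fun q : ι × ι => f₃ q.1 * f₄ q.2)) ≤
      r ^ 2 := by
  refine (kyFan_vecMulVec_le k _ _).trans (Real.sqrt_le_iff.mpr ⟨sq_nonneg _, ?_⟩)
  rw [sq (r ^ 2)]
  exact mul_le_mul (sum_norm_sq_mul_prod_le h₁ h₂) (sum_norm_sq_mul_prod_le h₃ h₄)
    (Finset.sum_nonneg fun i _ => by positivity) (sq_nonneg _)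

/-- Lemma 4.1, part 1: if a pure four-qudit state is fully separable, then the Ky Fan
`k`-norm of the realigned matrix `M^{(AB)(CD)}` is at most `(d-1)²`. -/
theorem kyFan_bound_fully_separable (d : ℕ) (hd : 2 ≤ d)
    (lam : Fin (d ^ 2 - 1) → Matrix (Fin d) (Fin d) ℂ)
    (hherm : ∀ i, (lam i).IsHermitian)
    (htr0 : ∀ i, (lam i).trace = 0)
    (horth : ∀ i j, (lam i * lam j).trace = if i = j then (d : ℂ) else 0)
    (ψ₁ ψ₂ ψ₃ ψ₄ : Fin d → ℂ)
    (h₁ : unitNorm ψ₁) (h₂ : unitNorm ψ₂) (h₃ : unitNorm ψ₃) (h₄ : unitNorm ψ₄)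
    (ρ : Matrix (Fin d × Fin d × Fin d × Fin d) (Fin d × Fin d × Fin d × Fin d) ℂ)
    (hρ : ρ = outer (fun p => ψ₁ p.1 * ψ₂ p.2.1 * ψ₃ p.2.2.1 * ψ₄ p.2.2.2))
    (k : ℕ) (hk1 : 1 ≤ k) (hk2 : k ≤ (d ^ 2 - 1) ^ 2) :
    kyFan k (MABCD lam ρ) ≤ ((d : ℝ) - 1) ^ 2 := by
  have hM : MABCD lam ρ = vecMulVec
      (fun p => (vecMulVec ψ₁ (star ψ₁) * lam p.1).trace *
        (vecMulVec ψ₂ (star ψ₂) * lam p.2).trace)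
      (fun q => (vecMulVec ψ₃ (star ψ₃) * lam q.1).trace *
        (vecMulVec ψ₄ (star ψ₄) * lam q.2).trace) := by
    ext p q
    rw [hρ, outer_product_eq_kron4, vecMulVec_apply, MABCD, of_apply, trace_kron4_mul_kron4]
  have hd0 : d ≠ 0 := (two_pos.trans_le hd).ne'
  have bessel {ψ : Fin d → ℂ} (hψ : unitNorm ψ) :=
    sum_norm_sq_trace_projector_mul_le hd0 lam hherm htr0 horth hψ
  rw [hM]
  convert kyFan_vecMulVec_prod_le k (bessel h₁) (bessel h₂) (bessel h₃) (bessel h₄) using 2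

end SpinCorrGME
end
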